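/- arXiv:0903.5179 — 4 statements merged into one kernel-verified Lean document; each statement's English description precedes it below -/
import Mathlib

section
/- Let k be a positive integer and let M, N be nonnegative integers with |M − N| ≤ k. Let w(l, p) be real numbers defined for integers 0 ≤ p ≤ l, and for each nonnegative integer l let p_l be the polynomial p_l(z) = ∑_{p=0}^{l} w(l, p) · z^p. Assume that for all integers l, p with 1 ≤ p ≤ l, the sum ∑_{r=0}^{l−p} C(2l, r) · w(l−r, p) is nonnegative. Then, writing the polynomial identity ∑_{l ∈ ℤ} C(M+N, M−kl)^2 · p_{|l|}(z) = ∑_{p ≥ 0} b_p · z^p (valid for all real z, with only finitely many b_p nonzero), one has b_p ≥ 0 for every p ≥ 1. -/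
/-- Binomial coefficient `C(n, b)` with integer lower index, zero unless `0 ≤ b ≤ n`. -/
def zchoose (n : ℕ) (b : ℤ) : ℕ := if 0 ≤ b then n.choose b.toNat else 0

open Finset LaurentPolynomial

/-- The symmetric Laurent polynomial `T ^ j + T ^ (-j)`. -/
noncomputable def symT (j : ℤ) : ℝ[T;T⁻¹] := T j + T (-j)

theorem symT_mul_symT (i j : ℤ) : symT i * symT j = symT (i + j) + symT (i - j) := by
  simp only [symT, add_mul, mul_add, ← T_add]
  rw [show -i + j = -(i - j) by ring, show -i + -j = -(i + j) by ring,
    show i + -j = i - j by ring]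
  abel

theorem symT_pow (j : ℤ) (m : ℕ) :
    symT j ^ m = ∑ i ∈ range (m + 1), (m.choose i : ℝ) • T (j * (m - 2 * i)) := by
  rw [symT, add_comm, add_pow]
  refine sum_congr rfl fun i hi => ?_
  have hi' : i ≤ m := by simpa [Nat.lt_succ_iff] using hi
  rw [T_pow, T_pow, ← T_add, mul_comm, Nat.cast_smul_eq_nsmul, nsmul_eq_mul]
  congr 2
  push_cast [hi']
  ring

theorem exists_linearMap_T (φ : ℤ → ℝ) : ∃ Φ : ℝ[T;T⁻¹] →ₗ[ℝ] ℝ, ∀ a, Φ (T a) = φ a := by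
  refine ⟨Finsupp.linearCombination ℝ φ ∘ₗ
    (AddMonoidAlgebra.coeffLinearEquiv ℝ).toLinearMap, fun a => ?_⟩
  change Finsupp.linearCombination ℝ φ (Finsupp.single a 1) = φ a
  simp

theorem map_symT_pow_mul_nonneg {k : ℕ} (hk : 0 < k) (Φ : ℝ[T;T⁻¹] →ₗ[ℝ] ℝ)
    (h : ∀ m j : ℕ, j < k → 0 ≤ Φ (symT k ^ m * symT j)) (n : ℕ) :
    ∀ m j : ℕ, j ≤ k → 0 ≤ Φ (symT 1 ^ n * (symT k ^ m * symT j)) := by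
  have symT_zero : symT 0 = 2 := by
    simp only [symT, neg_zero, T_zero]; norm_num
  have top (P : ℝ[T;T⁻¹]) (m : ℕ) :
      Φ (P * (symT k ^ m * symT k)) = 2⁻¹ * Φ (P * (symT k ^ (m + 1) * symT (0 : ℕ))) := by
    rw [Nat.cast_zero, symT_zero, show P * (symT k ^ (m + 1) * 2) =
      (2 : ℝ) • (P * (symT k ^ m * symT k)) by rw [two_smul]; ring, map_smul, smul_eq_mul]
    ring
  induction n with
  | zero =>
    intro m j hj
    rcases hj.lt_or_eq with hj | rfl
    · simpa using h m j hj
    · rw [top]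
      simpa using h (m + 1) 0 hk
  | succ n ih =>
    have low (m j : ℕ) (hj : j < k) : 0 ≤ Φ (symT 1 ^ (n + 1) * (symT k ^ m * symT j)) := by
      have key : symT 1 ^ (n + 1) * (symT k ^ m * symT j) =
          symT 1 ^ n * (symT k ^ m * symT (j + 1)) +
            symT 1 ^ n * (symT k ^ m * symT (j - 1)) := by
        rw [← mul_add, ← mul_add, ← symT_mul_symT]
        ring
      rw [key, map_add]
      have h1 := ih m (j + 1) hj
      push_cast at h1
      refine add_nonneg h1 ?_
      rcases j with _ | j
      · have h2 := ih m 1 hk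
        simpa [symT, add_comm] using h2
      · have h2 := ih m j (by omega)
        simpa using h2
    intro m j hj
    rcases hj.lt_or_eq with hj | rfl
    · exact low m j hj
    · rw [top]
      have := low (m + 1) 0 hk
      positivity

theorem choose_sq_eq_sum {n j : ℕ} (hj : j ≤ n) :
    n.choose j ^ 2 = ∑ i ∈ range (n + 1),
      if i ≤ j then n.choose (2 * i) * (2 * i).choose i * (n - 2 * i).choose (j - i) else 0 := by
  have vandermonde : n.choose j = ∑ i ∈ range (n + 1), j.choose i * (n - j).choose i := by
    have h := Nat.add_choose_eq j (n - j) j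
    rw [Nat.add_sub_cancel' hj, ← Finset.Nat.sum_antidiagonal_swap,
      Finset.Nat.sum_antidiagonal_eq_sum_range_succ_mk] at h
    rw [h]
    refine sum_subset_zero_on_sdiff (range_mono (by omega)) (fun i hi => ?_) fun i hi => ?_
    · simp only [mem_sdiff, mem_range] at hi
      rw [Nat.choose_eq_zero_of_lt (by omega : j < i), zero_mul]
    · simp only [Prod.swap, mem_range] at hi ⊢
      rw [Nat.choose_symm (by omega)]
  rw [sq]
  nth_rewrite 2 [vandermonde]
  rw [mul_sum]
  refine sum_congr rfl fun i _ => ?_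
  split_ifs with hi
  · have e1 := Nat.choose_mul (n := n) hi
    have e2 := Nat.choose_mul (n := n) (show i ≤ 2 * i by omega)
    have e3 := Nat.choose_mul (n := n - i) hi
    have e4 := Nat.choose_mul (n := n - i) (show j - i ≤ j by omega)
    rw [show n - i - (j - i) = n - j by omega, show j - (j - i) = i by omega,
      Nat.choose_symm hi] at e4
    rw [show 2 * i - i = i by omega] at e2
    rw [show n - i - i = n - 2 * i by omega] at e3
    rw [← mul_assoc, e1, e2, mul_assoc, ← e4, e3, mul_assoc]
  · rw [Nat.choose_eq_zero_of_lt (by omega : j < i)]; simp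

theorem sum_choose_sq_smul_T (n : ℕ) :
    ∑ j ∈ range (n + 1), ((n.choose j : ℝ) ^ 2) • (T ((n : ℤ) - 2 * j) : ℝ[T;T⁻¹]) =
      ∑ i ∈ range (n + 1),
        ((n.choose (2 * i) * (2 * i).choose i : ℕ) : ℝ) • symT 1 ^ (n - 2 * i) := by
  have expand (i : ℕ) (hi : 2 * i ≤ n) : symT 1 ^ (n - 2 * i) = ∑ j ∈ range (n + 1),
      if i ≤ j then ((n - 2 * i).choose (j - i) : ℝ) • (T ((n : ℤ) - 2 * j) : ℝ[T;T⁻¹])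
        else 0 := by
    rw [symT_pow]
    refine sum_of_injOn (fun a => a + i) (fun _ _ _ _ h => by simpa using h)
      (fun a ha => ?_) (fun j _ hj' => ?_) (fun a _ => ?_)
    · simp only [coe_range, Set.mem_Iio] at ha ⊢
      omega
    · split_ifs with hij
      · rw [Nat.choose_eq_zero_of_lt, Nat.cast_zero, zero_smul]
        by_contra! hlt
        exact hj' ⟨j - i, by simp only [coe_range, Set.mem_Iio]; omega, by simp only; omega⟩
      · rfl
    · rw [if_pos (by omega), Nat.add_sub_cancel]
      congr 2
      push_cast [hi]
      ring
  have swap : ∀ i ∈ range (n + 1),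
      ((n.choose (2 * i) * (2 * i).choose i : ℕ) : ℝ) • symT 1 ^ (n - 2 * i) =
      ∑ j ∈ range (n + 1), ((if i ≤ j then
        n.choose (2 * i) * (2 * i).choose i * (n - 2 * i).choose (j - i) else 0 : ℕ) : ℝ) •
          (T ((n : ℤ) - 2 * j) : ℝ[T;T⁻¹]) := by
    intro i _
    by_cases hi : 2 * i ≤ n
    · rw [expand i hi, smul_sum]
      refine sum_congr rfl fun j _ => ?_
      split_ifs
      · rw [smul_smul, Nat.cast_mul (_ * _)]
      · simp
    · simp [Nat.choose_eq_zero_of_lt (by omega : n < 2 * i)]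
  rw [sum_congr rfl swap, sum_comm]
  refine sum_congr rfl fun j hj => ?_
  rw [← sum_smul, ← Nat.cast_sum, ← choose_sq_eq_sum (by simpa [Nat.lt_succ_iff] using hj),
    Nat.cast_pow]

theorem two_mul_map_sum_choose_sq (Φ : ℝ[T;T⁻¹] →ₗ[ℝ] ℝ) (hΦ : ∀ a, Φ (T (-a)) = Φ (T a))
    (M N : ℕ) :
    2 * ∑ j ∈ range (M + N + 1), ((M + N).choose j : ℝ) ^ 2 * Φ (T (2 * (M - j))) =
      ∑ i ∈ range (M + N + 1), (((M + N).choose (2 * i) * (2 * i).choose i : ℕ) : ℝ) *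
        Φ (symT 1 ^ (M + N - 2 * i) * symT (M - N)) := by
  have hsum := congrArg (fun P => Φ (P * symT (M - N))) (sum_choose_sq_smul_T (M + N))
  simp only [sum_mul, smul_mul_assoc, map_sum, map_smul, smul_eq_mul] at hsum
  rw [← hsum, two_mul]
  nth_rewrite 2 [← sum_range_reflect]
  rw [← sum_add_distrib]
  refine sum_congr rfl fun j hj => ?_
  have hj' : j ≤ M + N := by simpa [Nat.lt_succ_iff] using hj
  rw [show M + N + 1 - 1 - j = M + N - j by omega, Nat.choose_symm hj', ← mul_add, symT,
    mul_add (T _), ← T_add, ← T_add, map_add, ← hΦ (2 * (M - (M + N - j : ℕ)))]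
  congr 4
  · push_cast; ring
  · push_cast [hj']; ring

theorem map_symT_pow_mul_symT_nonneg {k : ℕ} (W : ℕ → ℝ) (Φ : ℝ[T;T⁻¹] →ₗ[ℝ] ℝ)
    (hΦ : ∀ a, Φ (T a) = if (2 * k : ℤ) ∣ a then W (a / (2 * k)).natAbs else 0)
    (hW : ∀ l : ℕ, 0 ≤ ∑ i ∈ range (2 * l + 1), ((2 * l).choose i : ℝ) * W ((l : ℤ) - i).natAbs)
    (m j : ℕ) (hj : j < k) : 0 ≤ Φ (symT k ^ m * symT j) := by
  have expand : Φ (symT k ^ m * symT j) = ∑ i ∈ range (m + 1), (m.choose i : ℝ) *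
      (Φ (T (k * (m - 2 * i) + j)) + Φ (T (k * (m - 2 * i) - j))) := by
    rw [symT_pow, sum_mul, map_sum]
    refine sum_congr rfl fun i _ => ?_
    rw [smul_mul_assoc, map_smul, smul_eq_mul, symT, mul_add, ← T_add, ← T_add, map_add,
      ← sub_eq_add_neg]
  have hk : (k : ℤ) ≠ 0 := by omega
  rw [expand]
  rcases Nat.eq_zero_or_pos j with rfl | hj0
  · rcases m.even_or_odd' with ⟨l, rfl | rfl⟩
    · have hl := hW l
      have heq (i : ℕ) : Φ (T (k * ((2 * l : ℕ) - 2 * i))) = W ((l : ℤ) - i).natAbs := by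
        rw [hΦ, show (k : ℤ) * ((2 * l : ℕ) - 2 * i) = 2 * k * (l - i) by push_cast; ring,
          if_pos (dvd_mul_right _ _), Int.mul_ediv_cancel_left _ (by omega)]
      simp only [Nat.cast_zero, add_zero, sub_zero, heq, mul_add, sum_add_distrib]
      exact add_nonneg hl hl
    · refine (sum_eq_zero fun i _ => ?_).ge
      have hz : ¬ (2 * k : ℤ) ∣ k * ((2 * l + 1 : ℕ) - 2 * i) := by
        rw [mul_comm (2 : ℤ), mul_dvd_mul_iff_left hk]
        omega
      simp only [Nat.cast_zero, add_zero, sub_zero]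
      rw [hΦ, if_neg hz, add_zero, mul_zero]
  · refine (sum_eq_zero fun i _ => ?_).ge
    have hkj : ¬ (k : ℤ) ∣ j := fun h => by
      have := Nat.le_of_dvd hj0 (Int.natCast_dvd_natCast.mp h)
      omega
    have h1 : ¬ (2 * k : ℤ) ∣ k * (m - 2 * i) + j := fun h =>
      hkj ((Int.dvd_add_right (dvd_mul_right _ _)).mp ((dvd_mul_left _ _).trans h))
    have h2 : ¬ (2 * k : ℤ) ∣ k * (m - 2 * i) - j := fun h =>
      hkj ((dvd_sub_right (dvd_mul_right _ _)).mp ((dvd_mul_left _ _).trans h))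
    rw [hΦ, hΦ, if_neg h1, if_neg h2, add_zero, mul_zero]

theorem sum_choose_mul_natAbs_nonneg {p : ℕ} (hp : 1 ≤ p) (w : ℕ → ℝ)
    (hw : ∀ l : ℕ, p ≤ l → 0 ≤ ∑ r ∈ range (l - p + 1), ((2 * l).choose r : ℝ) * w (l - r))
    (l : ℕ) : 0 ≤ ∑ i ∈ range (2 * l + 1), ((2 * l).choose i : ℝ) *
      (fun a => if p ≤ a then w a else 0) ((l : ℤ) - i).natAbs := by
  have half : 0 ≤ ∑ i ∈ range l, ((2 * l).choose i : ℝ) * if p ≤ l - i then w (l - i) else 0 := by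
    by_cases hl : p ≤ l
    · refine (hw l hl).trans_eq (sum_subset_zero_on_sdiff (range_mono (by omega)) ?_ ?_)
      · intro i hi
        simp only [mem_sdiff, mem_range] at hi
        rw [if_neg (by omega), mul_zero]
      · intro i hi
        rw [mem_range] at hi
        rw [if_pos (by omega)]
    · refine (sum_eq_zero fun i _ => ?_).ge
      rw [if_neg (by omega), mul_zero]
  rw [show 2 * l + 1 = l + 1 + l by ring, sum_range_add, sum_range_succ]
  refine add_nonneg (add_nonneg (half.trans_eq (sum_congr rfl fun i hi => ?_)) ?_) ?_
  · rw [mem_range] at hi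
    rw [show ((l : ℤ) - i).natAbs = l - i by omega]
  · simp [show ¬ p ≤ 0 by omega]
  · rw [← sum_range_reflect]
    refine half.trans_eq (sum_congr rfl fun i hi => ?_)
    rw [mem_range] at hi
    rw [show ((l : ℤ) - (l + 1 + (l - 1 - i) : ℕ)).natAbs = l - i by omega,
      show l + 1 + (l - 1 - i) = 2 * l - i by omega, Nat.choose_symm (by omega)]

theorem sum_zchoose_sq_mul {k : ℕ} (hk : 0 < k) (M N : ℕ) (W : ℕ → ℝ) :
    ∑ l ∈ Icc (-((M : ℤ) + N)) ((M : ℤ) + N),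
        (zchoose (M + N) ((M : ℤ) - k * l) : ℝ) ^ 2 * W l.natAbs =
      ∑ j ∈ range (M + N + 1), ((M + N).choose j : ℝ) ^ 2 *
        if (2 * k : ℤ) ∣ 2 * (M - j) then W ((2 * ((M : ℤ) - j)) / (2 * k)).natAbs else 0 := by
  have hk' : (0 : ℤ) < k := by exact_mod_cast hk
  have bound {l : ℤ} (h0 : 0 ≤ (M : ℤ) - k * l) (h1 : (M : ℤ) - k * l ≤ M + N) :
      -((M : ℤ) + N) ≤ l ∧ l ≤ (M : ℤ) + N := by
    constructor <;> nlinarith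
  have support {l : ℤ}
      (h : (zchoose (M + N) ((M : ℤ) - k * l) : ℝ) ^ 2 * W l.natAbs ≠ 0) :
      0 ≤ (M : ℤ) - k * l ∧ (M : ℤ) - k * l ≤ M + N := by
    have hz : zchoose (M + N) ((M : ℤ) - k * l) ≠ 0 := by
      intro h0
      simp [h0] at h
    unfold zchoose at hz
    split_ifs at hz with h0
    · refine ⟨h0, ?_⟩
      by_contra! hlt
      exact hz (Nat.choose_eq_zero_of_lt (by omega))
    · exact absurd rfl hz
  have value (l : ℤ) (h0 : 0 ≤ (M : ℤ) - k * l) :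
      (zchoose (M + N) ((M : ℤ) - k * l) : ℝ) ^ 2 * W l.natAbs =
        ((M + N).choose ((M : ℤ) - k * l).toNat : ℝ) ^ 2 *
        if (2 * k : ℤ) ∣ 2 * (M - (((M : ℤ) - k * l).toNat : ℤ)) then
          W ((2 * ((M : ℤ) - (((M : ℤ) - k * l).toNat : ℤ))) / (2 * k)).natAbs else 0 := by
    rw [Int.toNat_of_nonneg h0, show 2 * ((M : ℤ) - (M - k * l)) = 2 * k * l by ring,
      if_pos (dvd_mul_right _ _), Int.mul_ediv_cancel_left _ (by omega), zchoose, if_pos h0]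
  refine sum_bij_ne_zero (fun l _ _ => ((M : ℤ) - k * l).toNat) (fun l _ h => ?_)
    (fun l _ h l' _ h' heq => ?_) (fun j hj h => ?_) (fun l _ h => value l (support h).1)
  · have := support h
    rw [mem_range]
    omega
  · have := support h
    have := support h'
    exact mul_left_cancel₀ hk'.ne' (by omega : (k : ℤ) * l = k * l')
  · have hd : (2 * k : ℤ) ∣ 2 * (M - j) := by
      by_contra hd
      simp [hd] at h
    rw [mul_dvd_mul_iff_left two_ne_zero] at hd
    obtain ⟨l, hl⟩ := hd
    rw [mem_range] at hj
    have hjl : ((M : ℤ) - k * l) = j := by omega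
    have hv := value l (by omega)
    simp only [hjl, Int.toNat_natCast] at hv
    have hb := bound (l := l) (by omega) (by omega)
    refine ⟨l, mem_Icc.mpr hb, ?_, by rw [hjl, Int.toNat_natCast]⟩
    rw [hjl, hv]
    exact h

theorem sum_zchoose_sq_nonneg {k M N p : ℕ} (hk : 0 < k) (h : |(M : ℤ) - N| ≤ k) (hp : 1 ≤ p)
    (w : ℕ → ℝ)
    (hw : ∀ l : ℕ, p ≤ l → 0 ≤ ∑ r ∈ range (l - p + 1), ((2 * l).choose r : ℝ) * w (l - r)) :
    0 ≤ ∑ l ∈ Icc (-((M : ℤ) + N)) ((M : ℤ) + N),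
      (zchoose (M + N) ((M : ℤ) - k * l) : ℝ) ^ 2 * if p ≤ l.natAbs then w l.natAbs else 0 := by
  set W : ℕ → ℝ := fun a => if p ≤ a then w a else 0
  obtain ⟨Φ, hΦ⟩ := exists_linearMap_T
    fun a => if (2 * k : ℤ) ∣ a then W (a / (2 * k)).natAbs else 0
  have hneg (a : ℤ) : Φ (T (-a)) = Φ (T a) := by
    simp only [hΦ, dvd_neg]
    split_ifs with hd
    · rw [Int.neg_ediv_of_dvd hd, Int.natAbs_neg]
    · rfl
  have hsymm (i : ℤ) : symT i = symT i.natAbs := by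
    rcases Int.natAbs_eq i with hi | hi
    · rw [← hi]
    · nth_rewrite 1 [hi]
      simp only [symT, neg_neg, add_comm]
  have hbase := map_symT_pow_mul_symT_nonneg W Φ hΦ (sum_choose_mul_natAbs_nonneg hp w hw)
  have key := two_mul_map_sum_choose_sq Φ hneg M N
  simp only [hΦ] at key
  rw [← sum_zchoose_sq_mul hk M N W] at key
  have hnonneg : 0 ≤ ∑ i ∈ range (M + N + 1),
      (((M + N).choose (2 * i) * (2 * i).choose i : ℕ) : ℝ) *
        Φ (symT 1 ^ (M + N - 2 * i) * symT (M - N)) := by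
    refine sum_nonneg fun i _ => mul_nonneg (Nat.cast_nonneg _) ?_
    have := map_symT_pow_mul_nonneg hk Φ hbase (M + N - 2 * i) 0 ((M : ℤ) - N).natAbs
      (by rw [abs_le] at h; omega)
    rwa [pow_zero, one_mul, ← hsymm] at this
  linarith

theorem stmt11 (k M N : ℕ) (hk : 0 < k) (h : |(M : ℤ) - N| ≤ k)
    (w : ℕ → ℕ → ℝ)
    (hw : ∀ l p : ℕ, 1 ≤ p → p ≤ l →
      0 ≤ ∑ r ∈ Finset.range (l - p + 1), ((2 * l).choose r : ℝ) * w (l - r) p)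
    (m : ℕ) (b : ℕ → ℝ) (hb0 : ∀ p, m ≤ p → b p = 0)
    (hb : ∀ z : ℝ,
      ∑ l ∈ Finset.Icc (-((M : ℤ) + N)) ((M : ℤ) + N),
        (zchoose (M + N) ((M : ℤ) - k * l) : ℝ) ^ 2 *
          ∑ p ∈ Finset.range (l.natAbs + 1), w l.natAbs p * z ^ p
      = ∑ p ∈ Finset.range m, b p * z ^ p) :
    ∀ p : ℕ, 1 ≤ p → 0 ≤ b p := by
  intro p hp
  have hpoly : ∑ l ∈ Finset.Icc (-((M : ℤ) + N)) ((M : ℤ) + N),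
        Polynomial.C ((zchoose (M + N) ((M : ℤ) - k * l) : ℝ) ^ 2) *
          ∑ p ∈ Finset.range (l.natAbs + 1), Polynomial.C (w l.natAbs p) * Polynomial.X ^ p
      = ∑ p ∈ Finset.range m, Polynomial.C (b p) * Polynomial.X ^ p := by
    refine Polynomial.funext fun z => ?_
    simpa [Polynomial.eval_finsetSum] using hb z
  have hcoeff := congrArg (fun P => P.coeff p) hpoly
  simp only [Polynomial.finsetSum_coeff, Polynomial.coeff_C_mul, Polynomial.coeff_X_pow,
    mul_ite, mul_one, mul_zero, sum_ite_eq, mem_range, Nat.lt_succ_iff] at hcoeff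
  have hbp : b p = if p < m then b p else 0 := by
    split_ifs with hpm
    · rfl
    · exact hb0 p (not_lt.mp hpm)
  rw [hbp, ← hcoeff]
  simpa using sum_zchoose_sq_nonneg hk h hp (fun l => w l p) fun l hl => hw l p hp hl
end

section
/- Let k be a positive integer and let M, N be nonnegative integers. Let w(l, p) be real numbers defined for integers 0 ≤ p ≤ l, and for each nonnegative integer l let p_l be the polynomial p_l(z) = ∑_{p=0}^{l} w(l, p) · z^p. Assume that for all integers l, p with 1 ≤ p ≤ l, the sum ∑_{r=0}^{l−p} C(2l, r) · w(l−r, p) is nonnegative. Then, writing the polynomial identity ∑_{l ∈ ℤ} C(M+N, M−kl) · C(M+N, N−kl) · p_{|l|}(z) = ∑_{p ≥ 0} c_p · z^p (valid for all real z, with only finitely many c_p nonzero), one has c_p ≥ 0 for every p ≥ 1. -/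
/-- The number of `n`-step walks on `ℤ` with steps `±1` from `0` to `x`. -/
def walkCount : ℕ → ℤ → ℕ
  | 0, x => if x = 0 then 1 else 0
  | n + 1, x => walkCount n (x - 1) + walkCount n (x + 1)

/-- The finite sums of walk-counting functions. -/
def walkCone : AddSubmonoid (ℤ → ℕ) := AddSubmonoid.closure (Set.range walkCount)

theorem zchoose_succ (n : ℕ) (b : ℤ) :
    zchoose (n + 1) b = zchoose n (b - 1) + zchoose n b := by
  unfold zchoose
  rcases lt_trichotomy b 0 with h | rfl | h
  · rw [if_neg (by omega), if_neg (by omega), if_neg (by omega)]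
  · simp
  · obtain ⟨c, rfl⟩ : ∃ c : ℕ, b = c + 1 := ⟨(b - 1).toNat, by omega⟩
    rw [if_pos (by omega), if_pos (by omega), if_pos (by omega)]
    have h1 : ((c : ℤ) + 1).toNat = c + 1 := by omega
    have h2 : ((c : ℤ) + 1 - 1).toNat = c := by omega
    rw [h1, h2, Nat.choose_succ_succ]

theorem walkCount_eq_zchoose (n : ℕ) (b : ℤ) : walkCount n (2 * b - n) = zchoose n b := by
  induction n generalizing b with
  | zero =>
    unfold zchoose walkCount
    rcases lt_trichotomy b 0 with h | rfl | h
    · rw [if_neg (by push_cast; omega), if_neg (by omega)]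
    · simp
    · rw [if_neg (by push_cast; omega), if_pos h.le, Nat.choose_eq_zero_of_lt (by omega)]
  | succ n ih =>
    rw [zchoose_succ, ← ih, ← ih, walkCount]
    congr 2 <;> push_cast <;> ring

theorem walkCount_neg (n : ℕ) (x : ℤ) : walkCount n (-x) = walkCount n x := by
  induction n generalizing x with
  | zero => simp [walkCount]
  | succ n ih =>
    rw [walkCount, walkCount, add_comm, ← ih (x - 1), ← ih (x + 1)]
    congr 2 <;> ring

theorem walkCount_eq_zero_of_odd (n : ℕ) (x : ℤ) (h : (n + x) % 2 = 1) : walkCount n x = 0 := by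
  induction n generalizing x with
  | zero => rw [walkCount, if_neg]; rintro rfl; simp at h
  | succ n ih =>
    push_cast at h
    rw [walkCount, ih _ (by omega), ih _ (by omega)]

theorem walkCount_mem_walkCone (n : ℕ) : walkCount n ∈ walkCone :=
  AddSubmonoid.subset_closure ⟨n, rfl⟩

theorem step_mem_walkCone {F : ℤ → ℕ} (hF : F ∈ walkCone) :
    (fun x => F (x - 1) + F (x + 1)) ∈ walkCone := by
  induction hF using AddSubmonoid.closure_induction with
  | mem F h =>
    obtain ⟨n, rfl⟩ := h
    exact walkCount_mem_walkCone (n + 1)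
  | zero => exact walkCone.zero_mem
  | add F G _ _ hF hG =>
    convert walkCone.add_mem hF hG using 1
    ext x
    simp only [Pi.add_apply]
    ring

/-- A pair of simultaneous walks is a walk in the half-sum and half-difference coordinates,
each step of which moves exactly one of the two. -/
theorem walkCount_mul_mem_walkCone (n : ℕ) (d : ℤ) :
    (fun x => walkCount n (x + d) * walkCount n (x - d)) ∈ walkCone := by
  induction n generalizing d with
  | zero =>
    by_cases hd : d = 0
    · convert walkCount_mem_walkCone 0 using 1
      ext x
      simp [walkCount, hd]
    · convert walkCone.zero_mem using 1
      ext x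
      simp only [walkCount, Pi.zero_apply, mul_eq_zero, ite_eq_right_iff, one_ne_zero]
      omega
  | succ n ih =>
    convert walkCone.add_mem (step_mem_walkCone (ih d))
      (walkCone.add_mem (ih (d - 1)) (ih (d + 1))) using 1
    ext x
    simp only [walkCount, Pi.add_apply]
    rw [show x - 1 + d = x + d - 1 by ring, show x + 1 + d = x + d + 1 by ring,
      show x - 1 - d = x - d - 1 by ring, show x + 1 - d = x - d + 1 by ring,
      show x + (d - 1) = x + d - 1 by ring, show x + (d + 1) = x + d + 1 by ring,
      show x - (d - 1) = x - d + 1 by ring, show x - (d + 1) = x - d - 1 by ring]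
    ring

/-- Decomposition of walks according to the last multiple of `k` visited: `H i` collects the walks
that are at distance `i` from it, as a function of that multiple. -/
theorem exists_walkCount_decomposition (k : ℕ) (hk : 0 < k) (n : ℕ) :
    ∃ H : ℕ → ℤ → ℕ, (∀ i, H i ∈ walkCone) ∧ H k = 0 ∧
      ∀ i ≤ k, ∀ x : ℤ, walkCount n (k * x + i) = H i x + H (k - i) (x + 1) := by
  induction n with
  | zero =>
    refine ⟨fun i => if i = 0 then walkCount 0 else 0, fun i => ?_, if_neg hk.ne', ?_⟩
    · dsimp only
      split_ifs
      exacts [walkCount_mem_walkCone 0, walkCone.zero_mem]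
    · intro i hi x
      have hk' : (0 : ℤ) < k := by exact_mod_cast hk
      rcases Nat.eq_zero_or_pos i with rfl | h0
      · simp [walkCount, hk.ne']
      rcases hi.eq_or_lt with rfl | hik
      · have : (i : ℤ) * x + i = 0 ↔ x + 1 = 0 := by
          rw [← mul_add_one, mul_eq_zero, or_iff_right hk'.ne']
        simp [walkCount, h0.ne', this]
      · have : (k : ℤ) * x + i ≠ 0 := by
          intro h
          rcases lt_or_ge x 0 with hx | hx
          · nlinarith [mul_le_mul_of_nonneg_left (show x ≤ -1 by omega) hk'.le]
          · nlinarith [mul_nonneg hk'.le hx]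
        simp [walkCount, h0.ne', this, show k - i ≠ 0 by omega]
  | succ n ih =>
    obtain ⟨H, hH, hHk, hn⟩ := ih
    have hstart (x : ℤ) : walkCount (n + 1) (k * x) =
        H 1 x + H 1 x + (H (k - 1) (x - 1) + H (k - 1) (x + 1)) := by
      have h1 := hn 1 hk x
      have h2 := hn (k - 1) (by omega) (x - 1)
      rw [show k - (k - 1) = 1 by omega, sub_add_cancel, Nat.cast_sub hk,
        show (k : ℤ) * (x - 1) + (k - (1 : ℕ)) = k * x - 1 by push_cast; ring] at h2
      rw [walkCount, h2]
      push_cast at h1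
      rw [h1]
      ring
    refine ⟨fun i => if i = 0 then H 1 + H 1 + fun x => H (k - 1) (x - 1) + H (k - 1) (x + 1)
      else if i < k then H (i - 1) + H (i + 1) else 0, fun i => ?_, ?_, ?_⟩
    · dsimp only
      split_ifs
      exacts [walkCone.add_mem (walkCone.add_mem (hH 1) (hH 1)) (step_mem_walkCone (hH _)),
        walkCone.add_mem (hH _) (hH _), walkCone.zero_mem]
    · simp [hk.ne']
    · intro i hi x
      rcases Nat.eq_zero_or_pos i with rfl | h0
      · simpa [hk.ne'] using hstart x
      rcases hi.eq_or_lt with rfl | hik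
      · simpa [h0.ne', mul_add_one] using hstart (x + 1)
      · have h1 := hn (i - 1) (by omega) x
        have h2 := hn (i + 1) (by omega) x
        rw [Nat.cast_sub h0, show k - (i - 1) = k - i + 1 by omega] at h1
        rw [show k - (i + 1) = k - i - 1 by omega] at h2
        push_cast at h1 h2
        rw [← add_sub_assoc] at h1
        rw [← add_assoc] at h2
        simp only [walkCount, h1, h2, h0.ne', hik, if_true, if_false, show k - i ≠ 0 by omega,
          show k - i < k by omega, Pi.add_apply]
        ring

theorem comp_mul_mem_walkCone (k : ℕ) (hk : 0 < k) {F : ℤ → ℕ} (hF : F ∈ walkCone) :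
    (fun x => F (k * x)) ∈ walkCone := by
  induction hF using AddSubmonoid.closure_induction with
  | mem F h =>
    obtain ⟨n, rfl⟩ := h
    obtain ⟨H, hH, hHk, hn⟩ := exists_walkCount_decomposition k hk n
    convert hH 0 using 1
    ext x
    simpa [hHk] using hn 0 (by omega) x
  | zero => exact walkCone.zero_mem
  | add F G _ _ hF hG => exact walkCone.add_mem hF hG

theorem eventually_sum_nonneg_of_mem_walkCone (v : ℕ → ℝ)
    (hv : ∀ l : ℕ, 0 ≤ ∑ j ∈ Finset.range (l + 1), ((2 * l).choose (l - j) : ℝ) * v j)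
    {F : ℤ → ℕ} (hF : F ∈ walkCone) :
    ∀ᶠ B in Filter.atTop, 0 ≤ ∑ j ∈ Finset.range (B + 1), (F (2 * j) : ℝ) * v j := by
  induction hF using AddSubmonoid.closure_induction with
  | mem F h =>
    obtain ⟨n, rfl⟩ := h
    rcases Nat.even_or_odd' n with ⟨l, rfl | rfl⟩
    · filter_upwards [Filter.eventually_ge_atTop l] with B hB
      have hc (j : ℕ) : walkCount (2 * l) (2 * j) = if j ≤ l then (2 * l).choose (l - j) else 0 := by
        rw [← walkCount_neg]
        have := walkCount_eq_zchoose (2 * l) (l - j)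
        rw [show 2 * ((l : ℤ) - j) - (2 * l : ℕ) = -(2 * j) by push_cast; ring] at this
        rw [this, zchoose]
        split_ifs <;> first | omega | rfl | (congr 1; omega)
      refine (hv l).trans_eq ?_
      rw [← Finset.sum_subset (Finset.range_mono (Nat.succ_le_succ hB))]
      · refine Finset.sum_congr rfl fun j hj => ?_
        rw [hc, if_pos (by simpa [Nat.lt_succ_iff] using hj)]
      · intro j _ hj
        rw [hc, if_neg (by simpa [Nat.lt_succ_iff] using hj)]
        simp
    · refine Filter.Eventually.of_forall fun B => le_of_eq ?_
      refine (Finset.sum_eq_zero fun j _ => ?_).symm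
      rw [walkCount_eq_zero_of_odd _ _ (by push_cast; omega)]
      simp
  | zero => simp
  | add F G _ _ hF hG =>
    filter_upwards [hF, hG] with B h1 h2
    simpa [add_mul, Finset.sum_add_distrib] using add_nonneg h1 h2

theorem coeff_eq_of_forall_sum_eq {ι : Type*} (s : Finset ι) (a : ι → ℝ) (d : ι → ℕ)
    (w : ℕ → ℕ → ℝ) (m : ℕ) (b : ℕ → ℝ) (hb0 : ∀ p, m ≤ p → b p = 0)
    (hb : ∀ z : ℝ, ∑ l ∈ s, a l * ∑ p ∈ Finset.range (d l + 1), w (d l) p * z ^ p =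
      ∑ p ∈ Finset.range m, b p * z ^ p) (p : ℕ) :
    b p = ∑ l ∈ s, a l * if p ≤ d l then w (d l) p else 0 := by
  have h : ∑ l ∈ s, Polynomial.C (a l) *
        ∑ p ∈ Finset.range (d l + 1), Polynomial.C (w (d l) p) * Polynomial.X ^ p =
      ∑ p ∈ Finset.range m, Polynomial.C (b p) * Polynomial.X ^ p := by
    refine Polynomial.funext fun z => ?_
    simpa [Polynomial.eval_finsetSum] using hb z
  have h' := congrArg (fun q => Polynomial.coeff q p) h
  simp only [Polynomial.finsetSum_coeff, Polynomial.coeff_C_mul, Polynomial.coeff_X_pow,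
    mul_ite, mul_one, mul_zero, Finset.sum_ite_eq, Finset.mem_range, Nat.lt_succ_iff] at h'
  by_cases hp : p < m
  · simpa [hp] using h'.symm
  · simpa [hp, hb0 p (not_lt.mp hp)] using h'.symm

theorem stmt12 (k M N : ℕ) (hk : 0 < k)
    (w : ℕ → ℕ → ℝ)
    (hw : ∀ l p : ℕ, 1 ≤ p → p ≤ l →
      0 ≤ ∑ r ∈ Finset.range (l - p + 1), ((2 * l).choose r : ℝ) * w (l - r) p)
    (m : ℕ) (b : ℕ → ℝ) (hb0 : ∀ p, m ≤ p → b p = 0)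
    (hb : ∀ z : ℝ,
      ∑ l ∈ Finset.Icc (-((M : ℤ) + N)) ((M : ℤ) + N),
        (zchoose (M + N) ((M : ℤ) - k * l) : ℝ) *
          (zchoose (M + N) ((N : ℤ) - k * l) : ℝ) *
          ∑ p ∈ Finset.range (l.natAbs + 1), w l.natAbs p * z ^ p
      = ∑ p ∈ Finset.range m, b p * z ^ p) :
    ∀ p : ℕ, 1 ≤ p → 0 ≤ b p := by
  intro p hp
  set v : ℕ → ℝ := fun l => if p ≤ l then w l p else 0 with hv_def
  have hv (l : ℕ) :
      0 ≤ ∑ j ∈ Finset.range (l + 1), ((2 * l).choose (l - j) : ℝ) * v j := by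
    rw [← Finset.sum_range_reflect]
    rcases le_or_gt p l with hpl | hpl
    · refine (hw l p hp hpl).trans_eq ?_
      rw [← Finset.sum_subset (Finset.range_mono (show l - p + 1 ≤ l + 1 by omega))]
      · refine Finset.sum_congr rfl fun r hr => ?_
        have hr := Finset.mem_range.mp hr
        rw [show l - (l + 1 - 1 - r) = r by omega, show l + 1 - 1 - r = l - r by omega]
        simp only [hv_def]
        rw [if_pos (by omega)]
      · intro r h1 h2
        rw [Finset.mem_range] at h1 h2
        simp only [hv_def]
        rw [if_neg (by omega), mul_zero]
    · refine (Finset.sum_eq_zero fun r _ => ?_).ge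
      simp only [hv_def]
      rw [if_neg (by omega), mul_zero]
  have hmem := comp_mul_mem_walkCone k hk (walkCount_mul_mem_walkCone (M + N) ((M : ℤ) - N))
  set F : ℤ → ℕ := fun x => walkCount (M + N) (k * x + ((M : ℤ) - N)) *
    walkCount (M + N) (k * x - ((M : ℤ) - N)) with hF_def
  have hF (l : ℤ) : zchoose (M + N) ((M : ℤ) - k * l) * zchoose (M + N) ((N : ℤ) - k * l) =
      F (2 * l) := by
    rw [← walkCount_eq_zchoose, ← walkCount_eq_zchoose, ← walkCount_neg,
      ← walkCount_neg _ (2 * _ - _), mul_comm]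
    simp only [hF_def]
    congr 2 <;> push_cast <;> ring
  have hF_neg (x : ℤ) : F (-x) = F x := by
    simp only [hF_def]
    rw [← walkCount_neg, ← walkCount_neg _ (k * -x - _), mul_comm]
    congr 2 <;> ring
  have hF_zero (j : ℕ) (hj : M + N < j) : F (2 * j) = 0 := by
    rw [← hF, zchoose, if_neg, zero_mul]
    have : (j : ℤ) ≤ k * j := le_mul_of_one_le_left (by omega) (by exact_mod_cast hk)
    omega
  rw [coeff_eq_of_forall_sum_eq _ _ Int.natAbs w m b hb0 hb p]
  have hsum := Finset.sum_Icc_of_even_eq_range (f := fun l => (F (2 * l) : ℝ) * v l.natAbs)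
    (fun x => by simp [hF_neg]) (M + N)
  obtain ⟨B, hB, hMN⟩ := ((eventually_sum_nonneg_of_mem_walkCone v hv hmem).and
    (Filter.eventually_ge_atTop (M + N))).exists
  rw [← Finset.sum_subset (Finset.range_mono (Nat.succ_le_succ hMN))] at hB
  · have := mul_nonneg (zero_le_two (α := ℝ)) hB
    refine this.trans_eq ?_
    refine Eq.trans ?_ (hsum.symm.trans ?_)
    · simp [hv_def, show p ≠ 0 by omega]
    · push_cast
      refine Finset.sum_congr rfl fun l _ => ?_
      rw [← hF]
      push_cast
      rfl
  · intro j _ hj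
    rw [hF_zero j (by simpa [Nat.lt_succ_iff] using hj)]
    simp
end

section
/- Let α, β be real numbers with −1 ≤ α + β ≤ 1 and β > −1, let k be a positive integer, and let M, N be nonnegative integers with |M − N| ≤ k. Then, writing the polynomial identity (in the real variable z) ∑_{l ∈ ℤ} C(M+N, M−kl)^2 · ((α+β+1)_{|l|} / (β+1)_{|l|}) · P_{|l|}^{(α,β)}(z − 1) = ∑_{p ≥ 0} b_p · z^p (with only finitely many b_p nonzero), one has b_p ≥ 0 for every p ≥ 1. -/
/-- The Pochhammer symbol `(a)_m = a (a+1) ⋯ (a+m−1)`. -/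
noncomputable def poch (a : ℝ) (m : ℕ) : ℝ := (ascPochhammer ℝ m).eval a

/-- The Jacobi polynomial `P_n^{(α,β)}` evaluated at `z − 1`, via the explicit formula
`P_n^{(α,β)}(z − 1) = ∑_{m=0}^{n} (−1)^{n−m} (n+α+β+1)_m (β+m+1)_{n−m} / (m! (n−m)!) (z/2)^m`. -/
noncomputable def jacobiShift (α β : ℝ) (n : ℕ) (z : ℝ) : ℝ :=
  ∑ m ∈ Finset.range (n + 1),
    (-1 : ℝ) ^ (n - m) *
      (poch ((n : ℝ) + α + β + 1) m * poch (β + m + 1) (n - m)) /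
        ((m.factorial : ℝ) * ((n - m).factorial : ℝ)) * (z / 2) ^ m

/-- Unnormalised evolution of the simple random walk on `ℤ`. -/
def walk : ℕ → (ℤ → ℝ) → ℤ → ℝ
  | 0, f, d => f d
  | n + 1, f, d => walk n f (d - 1) + walk n f (d + 1)

theorem walk_add (n : ℕ) (f g : ℤ → ℝ) (d : ℤ) :
    walk n (fun x => f x + g x) d = walk n f d + walk n g d := by
  induction n generalizing d with
  | zero => rfl
  | succ n ih => simp only [walk, ih]; ring

theorem walk_const_mul (n : ℕ) (c : ℝ) (f : ℤ → ℝ) (d : ℤ) :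
    walk n (fun x => c * f x) d = c * walk n f d := by
  induction n generalizing d with
  | zero => rfl
  | succ n ih => simp only [walk, ih]; ring

theorem walk_sum {ι : Type*} (s : Finset ι) (n : ℕ) (f : ι → ℤ → ℝ) (d : ℤ) :
    walk n (fun x => ∑ i ∈ s, f i x) d = ∑ i ∈ s, walk n (f i) d := by
  induction n generalizing d with
  | zero => rfl
  | succ n ih => simp only [walk, ih, Finset.sum_add_distrib]

theorem walk_comp_add (n : ℕ) (c : ℤ) (f : ℤ → ℝ) (d : ℤ) :
    walk n (fun x => f (c + x)) d = walk n f (c + d) := by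
  induction n generalizing d with
  | zero => rfl
  | succ n ih => simp only [walk, ih]; ring_nf

theorem walk_comp_sub (n : ℕ) (c : ℤ) (f : ℤ → ℝ) (d : ℤ) :
    walk n (fun x => f (c - x)) d = walk n f (c - d) := by
  induction n generalizing d with
  | zero => rfl
  | succ n ih => simp only [walk, ih]; ring_nf

theorem walk_neg {f : ℤ → ℝ} (hf : ∀ x, f (-x) = f x) (n : ℕ) (d : ℤ) :
    walk n f (-d) = walk n f d := by
  have h := walk_comp_sub n 0 f d
  simp only [zero_sub, hf] at h
  exact h.symm

theorem walk_congr {n : ℕ} {f g : ℤ → ℝ} {d : ℤ} (h : ∀ x, |x - d| ≤ n → f x = g x) :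
    walk n f d = walk n g d := by
  induction n generalizing d with
  | zero => exact h d (by simp)
  | succ n ih =>
    simp only [walk]
    rw [ih fun x hx => h x ?_, ih fun x hx => h x ?_] <;>
    · rw [abs_le] at hx ⊢
      push_cast
      constructor <;> linarith [hx.1, hx.2]

theorem walk_eq_sum (n : ℕ) (f : ℤ → ℝ) (d : ℤ) :
    walk n f d = ∑ j ∈ Finset.range (n + 1), (n.choose j : ℝ) * f (d + n - 2 * j) := by
  induction n generalizing d with
  | zero => simp [walk]
  | succ n ih =>
    rw [walk, ih, ih, Finset.sum_range_succ' _ (n + 1)]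
    simp only [Nat.choose_succ_succ, Nat.cast_add, add_mul, Finset.sum_add_distrib]
    refine Eq.trans ?_ (add_assoc _ _ _).symm
    congr 1
    · refine Finset.sum_congr rfl fun j _ => ?_
      congr 2
      push_cast
      ring
    · rw [Finset.sum_range_succ' _ n,
        Finset.sum_range_succ (fun j => (n.choose (j + 1) : ℝ) * _) n]
      simp only [Nat.choose_succ_self, Nat.cast_zero, zero_mul, add_zero, Nat.choose_zero_right]
      congr 1
      · refine Finset.sum_congr rfl fun j _ => ?_
        congr 2
        push_cast
        ring
      · congr 2
        push_cast
        ring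

/-- Maximum principle for the walk on an interval. -/
theorem walk_nonneg_of_boundary {k : ℕ} {f : ℤ → ℝ} (h0 : ∀ x : ℤ, |x| ≤ k → 0 ≤ f x)
    (hr : ∀ n, 0 ≤ walk n f k) (hl : ∀ n, 0 ≤ walk n f (-k)) (n : ℕ) (d : ℤ) (hd : |d| ≤ k) :
    0 ≤ walk n f d := by
  induction n generalizing d with
  | zero => exact h0 d hd
  | succ n ih =>
    rw [abs_le] at hd
    rcases hd.1.eq_or_lt with h | h
    · exact h ▸ hl _
    rcases hd.2.eq_or_lt with h' | h'
    · exact h' ▸ hr _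
    exact add_nonneg (ih _ (abs_le.2 ⟨by omega, by omega⟩)) (ih _ (abs_le.2 ⟨by omega, by omega⟩))

theorem walk_nonneg_of_even {k : ℕ} {f : ℤ → ℝ} (hf : ∀ x, f (-x) = f x)
    (h0 : ∀ x : ℤ, |x| ≤ k → 0 ≤ f x)
    (hb : ∀ n, 0 ≤ walk n (fun x => f (k + x) + f (k - x)) 0) (n : ℕ) (d : ℤ) (hd : |d| ≤ k) :
    0 ≤ walk n f d := by
  have hr (n : ℕ) : 0 ≤ walk n f k := by
    have h := hb n
    rw [walk_add, walk_comp_add, walk_comp_sub, add_zero, sub_zero] at h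
    linarith
  exact walk_nonneg_of_boundary h0 hr (fun n => by rw [walk_neg hf]; exact hr n) n d hd

/-- Reflecting an even function twice, about `k` and about `2k`, transfers positivity. -/
theorem walk_nonneg_of_reflect {k : ℕ} {f : ℤ → ℝ} (hf : ∀ x, f (-x) = f x)
    (h0 : ∀ x : ℤ, 0 ≤ x → x ≤ 2 * k → 0 ≤ f x)
    (hF : ∀ n, 0 ≤ walk n (fun x => f (2 * k + x) + f (2 * k - x) + 2 * f x) 0)
    (n : ℕ) (d : ℤ) (hd : |d| ≤ k) : 0 ≤ walk n f d := by
  refine walk_nonneg_of_even hf (fun x hx => ?_) (fun n => ?_) n d hd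
  · rw [abs_le] at hx
    rcases le_total 0 x with h | h
    · exact h0 x h (by omega)
    · exact hf x ▸ h0 (-x) (by omega) (by omega)
  · have hr (n : ℕ) : 0 ≤ walk n (fun x => f (k + x) + f (k - x)) k := by
      have h := hF n
      rw [walk_add, walk_add, walk_comp_add, walk_comp_sub, walk_const_mul, add_zero,
        sub_zero] at h
      rw [walk_add, walk_comp_add, walk_comp_sub, sub_self, ← two_mul]
      linarith
    refine walk_nonneg_of_boundary (k := k) (fun x hx => ?_) hr (fun n => ?_) n 0 (by simp)
    · rw [abs_le] at hx
      exact add_nonneg (h0 _ (by omega) (by omega)) (h0 _ (by omega) (by omega))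
    · rw [walk_neg fun x => ?_]
      · exact hr n
      · rw [sub_neg_eq_add, ← sub_eq_add_neg, add_comm]

theorem walk_single_neg (n : ℕ) (x : ℤ) :
    walk n (Pi.single 0 1) (-x) = walk n (Pi.single 0 1) x :=
  walk_neg (fun x => by simp [Pi.single_apply]) n x

theorem walk_single_nonneg (n : ℕ) (x : ℤ) : 0 ≤ walk n (Pi.single 0 1) x := by
  induction n generalizing x with
  | zero => simp only [walk, Pi.single_apply]; split_ifs <;> norm_num
  | succ n ih => exact add_nonneg (ih _) (ih _)

theorem walk_single_add_two_le (n : ℕ) (x : ℤ) (hx : -1 ≤ x) :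
    walk n (Pi.single 0 1) (x + 2) ≤ walk n (Pi.single 0 1) x := by
  induction n generalizing x with
  | zero =>
    simp only [walk, Pi.single_apply]
    rw [if_neg (by omega)]
    split_ifs <;> norm_num
  | succ n ih =>
    rcases hx.eq_or_lt with rfl | h
    · rw [← walk_single_neg]
      norm_num
    · have h1 := ih (x - 1) (by omega)
      have h2 := ih (x + 1) (by omega)
      simp only [walk]
      rw [show x + 2 - 1 = x - 1 + 2 by ring, show x + 2 + 1 = x + 1 + 2 by ring]
      linarith

theorem walk_single_antitone (n k : ℕ) :
    Antitone fun l : ℕ => walk n (Pi.single 0 1) ((k : ℤ) * (2 * l + 1)) := by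
  have aux (x : ℤ) (hx : 0 ≤ x) (t : ℕ) :
      walk n (Pi.single 0 1) (x + 2 * t) ≤ walk n (Pi.single 0 1) x := by
    induction t with
    | zero => simp
    | succ t ih =>
      refine le_trans ?_ ih
      rw [show x + 2 * ((t + 1 : ℕ) : ℤ) = x + 2 * t + 2 by push_cast; ring]
      exact walk_single_add_two_le n (x + 2 * t) (by omega)
  refine antitone_nat_of_succ_le fun l => ?_
  have h := aux ((k : ℤ) * (2 * l + 1)) (by positivity) k
  rwa [show (k : ℤ) * (2 * l + 1) + 2 * k = k * (2 * (l + 1 : ℕ) + 1) by push_cast; ring] at h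

theorem alternating_sum_mem {f : ℕ → ℝ} (hf : Antitone f) (h0 : ∀ i, 0 ≤ f i) (m : ℕ) :
    0 ≤ ∑ i ∈ Finset.range m, (-1 : ℝ) ^ i * f i ∧
      ∑ i ∈ Finset.range m, (-1 : ℝ) ^ i * f i ≤ f 0 := by
  induction m generalizing f with
  | zero => simpa using h0 0
  | succ m ih =>
    have h := ih (f := fun i => f (i + 1)) (fun a b hab => hf (by omega)) fun i => h0 _
    rw [Finset.sum_range_succ']
    simp only [pow_succ, pow_zero, mul_neg_one, neg_mul, one_mul, Finset.sum_neg_distrib]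
    have h1 : f 1 ≤ f 0 := hf zero_le_one
    simp only [zero_add] at h
    constructor <;> linarith [h.1, h.2]

/-- The function on `ℤ` supported on multiples of `2k` with value `g l` at `2kl`. -/
noncomputable def comb (k : ℕ) (g : ℤ → ℝ) (x : ℤ) : ℝ :=
  if (2 * k : ℤ) ∣ x then g (x / (2 * k)) else 0

section comb

variable {k : ℕ}

theorem comb_two_mul (hk : 0 < k) (g : ℤ → ℝ) (l : ℤ) : comb k g (2 * k * l) = g l := by
  rw [comb, if_pos (dvd_mul_right _ _), Int.mul_ediv_cancel_left _ (by positivity)]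

theorem comb_of_not_dvd (g : ℤ → ℝ) {x : ℤ} (hx : ¬ (2 * k : ℤ) ∣ x) : comb k g x = 0 :=
  if_neg hx

theorem comb_neg (hk : 0 < k) {g : ℤ → ℝ} (hg : ∀ l, g (-l) = g l) (x : ℤ) :
    comb k g (-x) = comb k g x := by
  by_cases hx : (2 * k : ℤ) ∣ x
  · obtain ⟨l, rfl⟩ := hx
    rw [← mul_neg, comb_two_mul hk, comb_two_mul hk, hg]
  · rw [comb_of_not_dvd g hx, comb_of_not_dvd g (by rwa [dvd_neg])]

theorem comb_nonneg (hk : 0 < k) {g : ℤ → ℝ} {x : ℤ} (h : ∀ l, x = 2 * k * l → 0 ≤ g l) :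
    0 ≤ comb k g x := by
  by_cases hd : (2 * k : ℤ) ∣ x
  · obtain ⟨l, rfl⟩ := hd
    rw [comb_two_mul hk]
    exact h l rfl
  · rw [comb_of_not_dvd g hd]

theorem comb_reflect (hk : 0 < k) {g g' : ℤ → ℝ} {c : ℝ}
    (h : ∀ l, g (1 + l) + g (1 - l) + 2 * g l = c * g' l) (x : ℤ) :
    comb k g (2 * k + x) + comb k g (2 * k - x) + 2 * comb k g x = c * comb k g' x := by
  by_cases hx : (2 * k : ℤ) ∣ x
  · obtain ⟨l, rfl⟩ := hx
    rw [show (2 * k + 2 * k * l : ℤ) = 2 * k * (1 + l) by ring,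
      show (2 * k - 2 * k * l : ℤ) = 2 * k * (1 - l) by ring]
    simp only [comb_two_mul hk, h]
  · rw [comb_of_not_dvd g hx, comb_of_not_dvd g' hx, comb_of_not_dvd, comb_of_not_dvd]
    · simp
    · rwa [dvd_sub_right (dvd_refl _)]
    · rwa [dvd_add_right (dvd_refl _)]

theorem walk_comb_reflect (hk : 0 < k) {g : ℤ → ℝ} (hg : ∀ l, g (-l) = g l) (n : ℕ) :
    walk n (fun x => comb k g (k + x) + comb k g (k - x)) 0 =
      2 * ∑ l ∈ Finset.range (n + 1),
        (g (l + 1) + g l) * walk n (Pi.single 0 1) ((k : ℤ) * (2 * l + 1)) := by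
  have hk' : (0 : ℤ) < k := by exact_mod_cast hk
  have hv : ∀ x : ℤ, |x - 0| ≤ n → comb k g (k + x) + comb k g (k - x) =
      ∑ l ∈ Finset.range (n + 1), (g (l + 1) + g l) *
        ((Pi.single 0 1 : ℤ → ℝ) (k * (2 * l + 1) + x) +
          (Pi.single 0 1 : ℤ → ℝ) (k * (2 * l + 1) - x)) := by
    have main : ∀ l : ℕ, (k : ℤ) * (2 * l + 1) ≤ n →
        comb k g (k + k * (2 * l + 1)) + comb k g (k - k * (2 * l + 1)) =
        ∑ i ∈ Finset.range (n + 1), (g (i + 1) + g i) *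
        ((Pi.single 0 1 : ℤ → ℝ) (k * (2 * i + 1) + k * (2 * l + 1)) +
          (Pi.single 0 1 : ℤ → ℝ) (k * (2 * i + 1) - k * (2 * l + 1))) := by
      intro l hl
      rw [Finset.sum_eq_single_of_mem l]
      · rw [show (k + k * (2 * l + 1) : ℤ) = 2 * k * (l + 1) by ring,
          show (k - k * (2 * l + 1) : ℤ) = 2 * k * (-l) by ring, comb_two_mul hk,
          comb_two_mul hk, hg, sub_self, Pi.single_eq_same, Pi.single_eq_of_ne (by positivity)]
        ring
      · rw [Finset.mem_range]
        zify
        nlinarith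
      · intro i _ hi
        rw [Pi.single_eq_of_ne (by positivity), Pi.single_eq_of_ne, add_zero, mul_zero]
        rw [← mul_sub]
        exact mul_ne_zero hk'.ne' (by omega)
    intro x hx
    rw [sub_zero, abs_le] at hx
    by_cases h1 : ∃ l : ℕ, x = k * (2 * l + 1)
    · obtain ⟨l, rfl⟩ := h1
      exact main l hx.2
    by_cases h2 : ∃ l : ℕ, -x = k * (2 * l + 1)
    · obtain ⟨l, hl⟩ := h2
      obtain rfl : x = -(k * (2 * l + 1)) := by omega
      rw [← sub_eq_add_neg, sub_neg_eq_add, add_comm, main l (by omega)]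
      refine Finset.sum_congr rfl fun i _ => ?_
      rw [← sub_eq_add_neg, sub_neg_eq_add, add_comm ((Pi.single 0 1 : ℤ → ℝ) _)]
    · have hodd : ∀ l : ℤ, x ≠ k * (2 * l + 1) := by
        intro l hl
        rcases le_total 0 l with h | h
        · exact h1 ⟨l.toNat, by rw [Int.toNat_of_nonneg h, hl]⟩
        · rcases h.eq_or_lt with rfl | h
          · exact h1 ⟨0, by simpa using hl⟩
          · refine h2 ⟨(-l - 1).toNat, ?_⟩
            rw [Int.toNat_of_nonneg (by omega), hl]
            ring
      rw [comb_of_not_dvd, comb_of_not_dvd, Finset.sum_eq_zero, add_zero]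
      · intro l _
        rw [Pi.single_eq_of_ne, Pi.single_eq_of_ne, add_zero, mul_zero]
        · exact fun h => hodd l (by linarith)
        · exact fun h => hodd (-l - 1) (by linarith)
      · rintro ⟨l, hl⟩
        exact hodd (-l) (by linarith)
      · rintro ⟨l, hl⟩
        exact hodd (l - 1) (by linarith)
  rw [walk_congr hv, walk_sum, Finset.mul_sum]
  refine Finset.sum_congr rfl fun l _ => ?_
  rw [walk_const_mul, walk_add, walk_comp_add, walk_comp_sub, add_zero, sub_zero]
  ring

theorem sum_eq_sum_comb (hk : 0 < k) (M N : ℕ) (w : ℤ → ℝ) (g : ℤ → ℝ)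
    (hw : ∀ j : ℤ, ¬ (0 ≤ j ∧ j ≤ M + N) → w j = 0) :
    ∑ l ∈ Finset.Icc (-((M : ℤ) + N)) ((M : ℤ) + N), w ((M : ℤ) - k * l) * g l =
      ∑ j ∈ Finset.range (M + N + 1), w j * comb k g (2 * M - 2 * j) := by
  have hk' : (0 : ℤ) < k := by exact_mod_cast hk
  refine Finset.sum_bij_ne_zero (fun l _ _ => ((M : ℤ) - k * l).toNat) ?_ ?_ ?_ ?_
  · intro l _ h
    have h1 := not_imp_comm.1 (hw _) (left_ne_zero_of_mul h)
    simp only [Finset.mem_range]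
    omega
  · intro l _ h l' _ h' he
    have h1 := not_imp_comm.1 (hw _) (left_ne_zero_of_mul h)
    have h2 := not_imp_comm.1 (hw _) (left_ne_zero_of_mul h')
    have : (k : ℤ) * l = k * l' := by omega
    exact mul_left_cancel₀ hk'.ne' this
  · intro j hj h
    rw [Finset.mem_range] at hj
    have hd : (2 * k : ℤ) ∣ 2 * M - 2 * j := by
      by_contra hd
      exact h (by rw [comb_of_not_dvd g hd, mul_zero])
    obtain ⟨l, hl⟩ := hd
    have hkl : (M : ℤ) - k * l = j := by linarith
    refine ⟨l, ?_, ?_, by rw [hkl, Int.toNat_natCast]⟩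
    · rw [Finset.mem_Icc]
      constructor <;> nlinarith
    · rwa [hkl, ← comb_two_mul hk g l, ← hl]
  · intro l _ h
    have h1 := not_imp_comm.1 (hw _) (left_ne_zero_of_mul h)
    rw [Int.toNat_of_nonneg h1.1, ← comb_two_mul hk g l]
    congr 2
    ring

end comb

theorem choose_mul_choose_mul_choose (a b i : ℕ) :
    (2 * i + (a + b)).choose (i + a) * ((i + a).choose i * (i + b).choose i) =
      (2 * i + (a + b)).choose (2 * i) * (2 * i).choose i * (a + b).choose a := by
  have h : (2 * i + (a + b)).choose (i + a) = ((i + a) + (i + b)).choose (i + a) := by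
    congr 1; ring
  rw [h, two_mul i]
  qify
  rw [Nat.cast_add_choose, Nat.cast_add_choose, Nat.cast_add_choose, Nat.cast_add_choose,
    Nat.cast_add_choose, Nat.cast_add_choose,
    show i + i + (a + b) = i + a + (i + b) by ring]
  field_simp [Nat.factorial_ne_zero]

theorem choose_sq (n j : ℕ) (hj : j ≤ n) :
    n.choose j ^ 2 = ∑ i ∈ Finset.range (n / 2 + 1),
      n.choose (2 * i) * (2 * i).choose i *
        (if i ≤ j then (n - 2 * i).choose (j - i) else 0) := by
  have hv : n.choose j = ∑ i ∈ Finset.range (n + 1), j.choose i * (n - j).choose i := by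
    conv_lhs => rw [← Nat.add_sub_cancel' hj]
    rw [Nat.add_choose_eq, Finset.Nat.sum_antidiagonal_eq_sum_range_succ_mk,
      ← Finset.sum_range_reflect]
    refine Finset.sum_subset_zero_on_sdiff (Finset.range_mono (by omega)) (fun i hi => ?_)
      fun i hi => ?_
    · simp only [Finset.mem_sdiff, Finset.mem_range] at hi
      rw [Nat.choose_eq_zero_of_lt (by omega), zero_mul]
    · rw [Finset.mem_range] at hi
      dsimp only
      rw [show j + 1 - 1 - i = j - i by omega, Nat.choose_symm (by omega),
        Nat.sub_sub_self (by omega)]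
  rw [sq]
  nth_rw 2 [hv]
  rw [Finset.mul_sum]
  symm
  refine Finset.sum_subset_zero_on_sdiff (Finset.range_mono (by omega)) (fun i hi => ?_)
    fun i hi => ?_
  · simp only [Finset.mem_sdiff, Finset.mem_range] at hi
    by_cases hij : i ≤ j
    · rw [Nat.choose_eq_zero_of_lt (show n - j < i by omega), mul_zero, mul_zero]
    · rw [Nat.choose_eq_zero_of_lt (show j < i by omega), zero_mul, mul_zero]
  · rw [Finset.mem_range] at hi
    split_ifs with hij
    · by_cases hin : i ≤ n - j
      · obtain ⟨a, rfl⟩ := Nat.exists_eq_add_of_le hij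
        obtain ⟨b, hb⟩ := Nat.exists_eq_add_of_le hin
        obtain rfl : n = 2 * i + (a + b) := by omega
        rw [hb, choose_mul_choose_mul_choose, Nat.add_sub_cancel_left, Nat.add_sub_cancel_left]
      · rw [Nat.choose_eq_zero_of_lt (show n - j < i by omega),
          Nat.choose_eq_zero_of_lt (show n - 2 * i < j - i by omega), mul_zero, mul_zero, mul_zero]
    · rw [Nat.choose_eq_zero_of_lt (show j < i by omega), zero_mul, mul_zero, mul_zero]

theorem sum_choose_sq_nonneg {k M N : ℕ} (h : |(M : ℤ) - N| ≤ k) {f : ℤ → ℝ}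
    (hf : ∀ (n : ℕ) (d : ℤ), |d| ≤ k → 0 ≤ walk n f d) :
    0 ≤ ∑ j ∈ Finset.range (M + N + 1),
      ((M + N).choose j : ℝ) ^ 2 * f (2 * M - 2 * j) := by
  have key : ∑ j ∈ Finset.range (M + N + 1), ((M + N).choose j : ℝ) ^ 2 * f (2 * M - 2 * j) =
      ∑ i ∈ Finset.range ((M + N) / 2 + 1), ((M + N).choose (2 * i) * (2 * i).choose i : ℝ) *
        walk (M + N - 2 * i) f (M - N) := by
    have hsq : ∀ j ∈ Finset.range (M + N + 1),
        ((M + N).choose j : ℝ) ^ 2 * f (2 * M - 2 * j) =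
          ∑ i ∈ Finset.range ((M + N) / 2 + 1),
            ((M + N).choose (2 * i) * (2 * i).choose i : ℝ) *
              ((if i ≤ j then ((M + N - 2 * i).choose (j - i) : ℝ) else 0) *
                f (2 * M - 2 * j)) := by
      intro j hj
      rw [← Nat.cast_pow, choose_sq _ _ (Nat.lt_succ_iff.1 (Finset.mem_range.1 hj))]
      push_cast
      rw [Finset.sum_mul]
      exact Finset.sum_congr rfl fun i _ => mul_assoc _ _ _
    rw [Finset.sum_congr rfl hsq, Finset.sum_comm]
    refine Finset.sum_congr rfl fun i hi => ?_
    rw [← Finset.mul_sum, walk_eq_sum]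
    congr 1
    rw [Finset.mem_range] at hi
    obtain ⟨r, hr⟩ := Nat.exists_eq_add_of_le (show 2 * i ≤ M + N by omega)
    rw [hr, Nat.add_sub_cancel_left, show 2 * i + r + 1 = i + (r + 1) + i by ring,
      Finset.sum_range_add, Finset.sum_range_add, Finset.sum_eq_zero, zero_add,
      Finset.sum_eq_zero (s := Finset.range i), add_zero]
    · refine Finset.sum_congr rfl fun j _ => ?_
      rw [if_pos (by omega), Nat.add_sub_cancel_left]
      congr 2
      push_cast
      omega
    · intro j _
      rw [Nat.choose_eq_zero_of_lt (by omega)]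
      simp
    · intro j hj
      rw [Finset.mem_range] at hj
      rw [if_neg (by omega), zero_mul]
  rw [key]
  exact Finset.sum_nonneg fun i _ => mul_nonneg (by positivity) (hf _ _ h)

theorem poch_succ (a : ℝ) (n : ℕ) : poch a (n + 1) = poch a n * (a + n) :=
  ascPochhammer_succ_eval n a

theorem poch_add (a : ℝ) (n m : ℕ) : poch a (n + m) = poch a n * poch (a + n) m := by
  induction m with
  | zero => simp [poch]
  | succ m ih =>
    rw [← add_assoc, poch_succ, poch_succ, ih]
    push_cast
    ring

theorem poch_pos {a : ℝ} (ha : 0 < a) (n : ℕ) : 0 < poch a n :=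
  ascPochhammer_pos n a ha

theorem poch_nonneg {a : ℝ} (ha : 0 ≤ a) (n : ℕ) : 0 ≤ poch a n := by
  induction n with
  | zero => simp [poch]
  | succ n ih => rw [poch_succ]; positivity

/-- Up to a positive factor, the coefficient of `z ^ p` in the Gegenbauer polynomial of degree
`|l|` and parameter `(s + 1) / 2`, evaluated at `z - 1`. -/
noncomputable def gegenbauerCoeff (s : ℝ) (p : ℕ) (l : ℤ) : ℝ :=
  if p ≤ l.natAbs then
    (-1) ^ (l.natAbs + p) * poch (s + 1) (l.natAbs + p) / ((l.natAbs - p).factorial : ℝ)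
  else 0

theorem gegenbauerCoeff_neg (s : ℝ) (p : ℕ) (l : ℤ) :
    gegenbauerCoeff s p (-l) = gegenbauerCoeff s p l := by
  simp only [gegenbauerCoeff, Int.natAbs_neg]

theorem gegenbauerCoeff_of_lt (s : ℝ) {p n : ℕ} (h : n < p) : gegenbauerCoeff s p n = 0 :=
  if_neg (by simpa using h)

theorem gegenbauerCoeff_add (s : ℝ) (p t : ℕ) :
    gegenbauerCoeff s p ((p + t : ℕ) : ℤ) =
      (-1) ^ t * poch (s + 1) (2 * p + t) / (t.factorial : ℝ) := by
  rw [gegenbauerCoeff, Int.natAbs_natCast, if_pos (Nat.le_add_right p t), Nat.add_sub_cancel_left,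
    show p + t + p = 2 * p + t by ring, pow_add, pow_mul]
  simp

theorem gegenbauerCoeff_reflect_natCast (s : ℝ) (p n : ℕ) :
    gegenbauerCoeff s (p + 1) (1 + n) + gegenbauerCoeff s (p + 1) (1 - n) +
        2 * gegenbauerCoeff s (p + 1) n =
      (s + 2 * p + 2) * (s + 2 * p + 1) *
        (gegenbauerCoeff s p n + if p = 0 ∧ (n : ℤ) = 0 then 1 else 0) := by
  rcases n with _ | n
  · have h1 := gegenbauerCoeff_of_lt s (p := p + 1) (n := 0) (by omega)
    rw [h1, Nat.cast_zero, add_zero, sub_zero]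
    rcases p with _ | p
    · have h2 := gegenbauerCoeff_add s 1 0
      have h3 := gegenbauerCoeff_add s 0 0
      simp only [add_zero, Nat.cast_one, Nat.cast_zero, mul_one, mul_zero] at h2 h3
      rw [poch_succ _ 1] at h2
      simp [h2, h3, poch]
      ring
    · have h2 := gegenbauerCoeff_of_lt s (p := p + 1 + 1) (n := 1) (by omega)
      have h3 := gegenbauerCoeff_of_lt s (p := p + 1) (n := 0) (by omega)
      rw [Nat.cast_one] at h2
      rw [Nat.cast_zero] at h3
      rw [h2, h3]
      simp
  · rw [if_neg (by omega), add_zero, show (1 - (n + 1 : ℕ) : ℤ) = -n by push_cast; ring,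
      gegenbauerCoeff_neg, show (1 + (n + 1 : ℕ) : ℤ) = (n + 2 : ℕ) by push_cast; ring]
    rcases lt_trichotomy (n + 1) p with h | h | h
    · rw [gegenbauerCoeff_of_lt s (by omega), gegenbauerCoeff_of_lt s (by omega),
        gegenbauerCoeff_of_lt s (by omega), gegenbauerCoeff_of_lt s (by omega)]
      simp
    · subst h
      have h1 := gegenbauerCoeff_add s (n + 1 + 1) 0
      have h2 := gegenbauerCoeff_add s (n + 1) 0
      simp only [add_zero] at h1 h2
      rw [h1, h2, gegenbauerCoeff_of_lt s (by omega), gegenbauerCoeff_of_lt s (by omega),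
        show 2 * (n + 1 + 1) = 2 * (n + 1) + 1 + 1 by ring, poch_succ, poch_succ]
      push_cast
      ring
    · obtain ⟨t, ht⟩ := Nat.exists_eq_add_of_lt h
      obtain rfl : n = p + t := by omega
      have h1 := gegenbauerCoeff_add s (p + 1) (t + 1)
      have h2 := gegenbauerCoeff_add s (p + 1) t
      have h3 := gegenbauerCoeff_add s p (t + 1)
      rw [show p + 1 + (t + 1) = p + t + 2 by ring,
        show 2 * (p + 1) + (t + 1) = 2 * p + t + 1 + 1 + 1 by ring, poch_succ, poch_succ,
        poch_succ, Nat.factorial_succ] at h1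
      rw [show p + 1 + t = p + t + 1 by ring,
        show 2 * (p + 1) + t = 2 * p + t + 1 + 1 by ring, poch_succ, poch_succ] at h2
      rw [← add_assoc, ← add_assoc, poch_succ, Nat.factorial_succ] at h3
      rw [h1, h2, h3]
      rcases t with _ | t
      · rw [add_zero, gegenbauerCoeff_of_lt s (by omega)]
        simp
        ring
      · have h4 := gegenbauerCoeff_add s (p + 1) t
        rw [show p + 1 + t = p + (t + 1) by ring,
          show 2 * (p + 1) + t = 2 * p + (t + 1) + 1 by ring, poch_succ] at h4
        rw [h4, Nat.factorial_succ]
        push_cast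
        field_simp
        ring

theorem gegenbauerCoeff_reflect (s : ℝ) (p : ℕ) (l : ℤ) :
    gegenbauerCoeff s (p + 1) (1 + l) + gegenbauerCoeff s (p + 1) (1 - l) +
        2 * gegenbauerCoeff s (p + 1) l =
      (s + 2 * p + 2) * (s + 2 * p + 1) *
        (gegenbauerCoeff s p l + if p = 0 ∧ l = 0 then 1 else 0) := by
  obtain ⟨n, rfl | rfl⟩ := l.eq_nat_or_neg
  · exact gegenbauerCoeff_reflect_natCast s p n
  · have h := gegenbauerCoeff_reflect_natCast s p n
    simp only [gegenbauerCoeff_neg, sub_neg_eq_add, ← sub_eq_add_neg, neg_eq_zero]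
    rw [← h]
    ring

theorem walk_comb_gegenbauerCoeff_zero_nonneg {s : ℝ} (hs : -1 ≤ s) (hs' : s ≤ 1) {k : ℕ}
    (hk : 0 < k) (n : ℕ) :
    0 ≤ walk n (comb k fun l => gegenbauerCoeff s 0 l + if l = 0 then 1 else 0) 0 := by
  have hk' : (0 : ℤ) < k := by exact_mod_cast hk
  have heven (l : ℤ) : (gegenbauerCoeff s 0 (-l) + if -l = 0 then (1 : ℝ) else 0) =
      gegenbauerCoeff s 0 l + if l = 0 then 1 else 0 := by
    simp only [gegenbauerCoeff_neg, neg_eq_zero]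
  have hcoeff (l : ℕ) : gegenbauerCoeff s 0 l = (-1) ^ l * poch (s + 1) l / (l.factorial : ℝ) := by
    simpa using gegenbauerCoeff_add s 0 l
  refine walk_nonneg_of_even (k := k) (comb_neg hk heven) (fun x hx => ?_) (fun n => ?_) n 0
    (by simp)
  · refine comb_nonneg hk fun l hl => ?_
    subst hl
    rw [abs_le] at hx
    obtain rfl : l = 0 := by
      have h1 : l < 1 := by nlinarith
      have h2 : -1 < l := by nlinarith
      omega
    have := hcoeff 0
    rw [Nat.cast_zero] at this
    rw [this]
    simp [poch]
  · rw [walk_comb_reflect hk heven, Finset.sum_range_succ']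
    set κ : ℕ → ℝ := fun l => walk n (Pi.single 0 1) ((k : ℤ) * (2 * l + 1))
    have hκ_anti : Antitone κ := walk_single_antitone n k
    have hκ_nonneg (l : ℕ) : 0 ≤ κ l := walk_single_nonneg _ _
    set q : ℕ → ℝ := fun l => poch (s + 1) (l + 1) / ((l + 2).factorial : ℝ) with hq
    have hq_nonneg (l : ℕ) : 0 ≤ q l :=
      div_nonneg (poch_nonneg (by linarith) _) (by positivity)
    have hq_anti : Antitone q := by
      refine antitone_nat_of_succ_le fun l => ?_
      have : q (l + 1) = q l * ((s + 1 + (l + 1)) / (l + 3)) := by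
        simp only [hq]
        rw [poch_succ _ (l + 1), show l + 1 + 2 = l + 2 + 1 by ring, Nat.factorial_succ (l + 2)]
        push_cast
        field_simp
        ring
      rw [this]
      refine mul_le_of_le_one_right (hq_nonneg l) ?_
      rw [div_le_one (by positivity)]
      linarith
    have halt := alternating_sum_mem (f := fun l => q l * κ (l + 1))
      (fun a b hab => mul_le_mul (hq_anti hab) (hκ_anti (by omega)) (hκ_nonneg _) (hq_nonneg _))
      (fun l => mul_nonneg (hq_nonneg _) (hκ_nonneg _)) n
    have hq0 : q 0 ≤ 1 := by
      have : q 0 = (s + 1) / 2 := by simp [hq, poch]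
      rw [this]
      linarith
    have hle : q 0 * κ (0 + 1) ≤ κ 0 :=
      (mul_le_of_le_one_left (hκ_nonneg _) hq0).trans (hκ_anti (Nat.zero_le _))
    have hsum : ∑ l ∈ Finset.range n,
        ((gegenbauerCoeff s 0 (((l + 1 : ℕ) : ℤ) + 1) +
            if ((l + 1 : ℕ) : ℤ) + 1 = 0 then 1 else 0)
          + (gegenbauerCoeff s 0 ((l + 1 : ℕ) : ℤ) + if ((l + 1 : ℕ) : ℤ) = 0 then 1 else 0)) *
          κ (l + 1) = s * ∑ l ∈ Finset.range n, (-1 : ℝ) ^ l * (q l * κ (l + 1)) := by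
      rw [Finset.mul_sum]
      refine Finset.sum_congr rfl fun l _ => ?_
      have h2 : ((l + 1 : ℕ) : ℤ) + 1 = ((l + 2 : ℕ) : ℤ) := by push_cast; ring
      rw [h2, if_neg (by omega), if_neg (by omega), hcoeff, hcoeff]
      simp only [hq]
      rw [poch_succ _ (l + 1), Nat.factorial_succ (l + 1)]
      push_cast
      field_simp
      ring
    have hzero : (gegenbauerCoeff s 0 (((0 : ℕ) : ℤ) + 1) + if ((0 : ℕ) : ℤ) + 1 = 0 then 1 else 0)
        + (gegenbauerCoeff s 0 ((0 : ℕ) : ℤ) + if ((0 : ℕ) : ℤ) = 0 then 1 else 0) = 1 - s := by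
      have h1 := hcoeff 1
      have h0 := hcoeff 0
      rw [Nat.cast_zero] at h0
      rw [Nat.cast_one] at h1
      rw [Nat.cast_zero, zero_add, h1, h0]
      simp [poch]
      ring
    refine mul_nonneg zero_le_two ?_
    rw [hzero]
    refine le_of_le_of_eq ?_ (congrArg (· + (1 - s) * κ 0) hsum.symm)
    have h0 := hκ_nonneg 0
    rcases le_total 0 s with h | h
    · exact add_nonneg (mul_nonneg h halt.1) (mul_nonneg (by linarith) h0)
    · have := mul_le_mul_of_nonpos_left (halt.2.trans hle) h
      linarith

theorem walk_comb_gegenbauerCoeff_nonneg {s : ℝ} (hs : -1 ≤ s) (hs' : s ≤ 1) {k : ℕ}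
    (hk : 0 < k) (p n : ℕ) (d : ℤ) (hd : |d| ≤ k) :
    0 ≤ walk n (comb k (gegenbauerCoeff s (p + 1))) d := by
  have hF (p n : ℕ) (hpos : 0 ≤ walk n (comb k fun l => gegenbauerCoeff s p l +
      if p = 0 ∧ l = 0 then 1 else 0) 0) :
      0 ≤ walk n (fun x => comb k (gegenbauerCoeff s (p + 1)) (2 * k + x) +
        comb k (gegenbauerCoeff s (p + 1)) (2 * k - x) +
        2 * comb k (gegenbauerCoeff s (p + 1)) x) 0 := by
    simp only [comb_reflect hk (gegenbauerCoeff_reflect s p), walk_const_mul]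
    have hp : (0 : ℝ) ≤ p := p.cast_nonneg
    exact mul_nonneg (mul_nonneg (by linarith) (by linarith)) hpos
  have h0 (p : ℕ) (x : ℤ) (hx0 : 0 ≤ x) (hx : x ≤ 2 * k) :
      0 ≤ comb k (gegenbauerCoeff s (p + 1)) x := by
    refine comb_nonneg hk fun l hl => ?_
    subst hl
    have hk' : (0 : ℤ) < k := by exact_mod_cast hk
    have hl0 : 0 ≤ l := by nlinarith
    have hl1 : l ≤ 1 := by nlinarith
    obtain ⟨l, rfl⟩ := Int.eq_ofNat_of_zero_le hl0
    rcases lt_or_ge l (p + 1) with h | h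
    · rw [gegenbauerCoeff_of_lt s h]
    · obtain rfl : l = p + 1 + 0 := by omega
      rw [gegenbauerCoeff_add]
      have := poch_nonneg (show 0 ≤ s + 1 by linarith) (2 * (p + 1) + 0)
      simpa using this
  induction p generalizing n d with
  | zero =>
    refine walk_nonneg_of_reflect (comb_neg hk (gegenbauerCoeff_neg s _)) (h0 0)
      (fun n => hF 0 n ?_) n d hd
    simpa using walk_comb_gegenbauerCoeff_zero_nonneg hs hs' hk n
  | succ p ih =>
    refine walk_nonneg_of_reflect (comb_neg hk (gegenbauerCoeff_neg s _)) (h0 _)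
      (fun n => hF (p + 1) n ?_) n d hd
    simpa using ih n 0 (by simp)

theorem sum_zchoose_sq_gegenbauerCoeff_nonneg {s : ℝ} (hs : -1 ≤ s) (hs' : s ≤ 1) {k M N : ℕ}
    (hk : 0 < k) (h : |(M : ℤ) - N| ≤ k) (p : ℕ) :
    0 ≤ ∑ l ∈ Finset.Icc (-((M : ℤ) + N)) ((M : ℤ) + N),
      (zchoose (M + N) ((M : ℤ) - k * l) : ℝ) ^ 2 * gegenbauerCoeff s (p + 1) l := by
  rw [sum_eq_sum_comb hk M N (fun j => (zchoose (M + N) j : ℝ) ^ 2)]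
  · simpa [zchoose] using
      sum_choose_sq_nonneg h (walk_comb_gegenbauerCoeff_nonneg hs hs' hk p)
  · intro j hj
    simp only [zchoose]
    split_ifs with h0
    · rw [Nat.choose_eq_zero_of_lt (by omega)]
      simp
    · simp

/-- `z ↦ jacobiShift α β n z` as a polynomial. -/
noncomputable def jacobiPoly (α β : ℝ) (n : ℕ) : Polynomial ℝ :=
  ∑ m ∈ Finset.range (n + 1), Polynomial.monomial m
    ((-1 : ℝ) ^ (n - m) *
      (poch ((n : ℝ) + α + β + 1) m * poch (β + m + 1) (n - m)) /
        ((m.factorial : ℝ) * ((n - m).factorial : ℝ)) * (1 / 2) ^ m)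

theorem eval_jacobiPoly (α β : ℝ) (n : ℕ) (z : ℝ) :
    (jacobiPoly α β n).eval z = jacobiShift α β n z := by
  rw [jacobiPoly, jacobiShift, Polynomial.eval_finsetSum]
  refine Finset.sum_congr rfl fun m _ => ?_
  rw [Polynomial.eval_monomial, mul_assoc, ← mul_pow, one_div_mul_eq_div]

theorem poch_mul_coeff_jacobiPoly {α β : ℝ} (hβ : -1 < β) (l : ℤ) (p : ℕ) :
    poch (α + β + 1) l.natAbs / poch (β + 1) l.natAbs * (jacobiPoly α β l.natAbs).coeff p =
      (1 / 2) ^ p / ((p.factorial : ℝ) * poch (β + 1) p) * gegenbauerCoeff (α + β) p l := by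
  simp only [jacobiPoly, Polynomial.finsetSum_coeff, Polynomial.coeff_monomial,
    Finset.sum_ite_eq', Finset.mem_range, Nat.lt_succ_iff, gegenbauerCoeff]
  split_ifs with h
  · obtain ⟨t, ht⟩ := Nat.exists_eq_add_of_le h
    have hβ' : 0 < β + 1 := by linarith
    have h1 := (poch_pos hβ' p).ne'
    have h2 : poch (β + 1 + p) t ≠ 0 := (poch_pos (by positivity) t).ne'
    rw [poch_add (α + β + 1) l.natAbs p, ht, Nat.add_sub_cancel_left, poch_add (β + 1) p t,
      show p + t + p = 2 * p + t by ring, pow_add _ (2 * p), pow_mul,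
      show β + p + 1 = β + 1 + p by ring,
      show ((p + t : ℕ) : ℝ) + α + β + 1 = α + β + 1 + ((p + t : ℕ) : ℝ) by ring]
    simp only [neg_one_sq, one_pow, one_mul]
    field_simp
  · simp

theorem stmt13 (α β : ℝ) (hab : -1 ≤ α + β) (hab' : α + β ≤ 1) (hβ : -1 < β)
    (k M N : ℕ) (hk : 0 < k) (h : |(M : ℤ) - N| ≤ k)
    (m : ℕ) (b : ℕ → ℝ) (hb0 : ∀ p, m ≤ p → b p = 0)
    (hb : ∀ z : ℝ,
      ∑ l ∈ Finset.Icc (-((M : ℤ) + N)) ((M : ℤ) + N),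
        (zchoose (M + N) ((M : ℤ) - k * l) : ℝ) ^ 2 *
          (poch (α + β + 1) l.natAbs / poch (β + 1) l.natAbs) * jacobiShift α β l.natAbs z
      = ∑ p ∈ Finset.range m, b p * z ^ p) :
    ∀ p : ℕ, 1 ≤ p → 0 ≤ b p := by
  have hpoly : ∑ l ∈ Finset.Icc (-((M : ℤ) + N)) ((M : ℤ) + N),
      Polynomial.C ((zchoose (M + N) ((M : ℤ) - k * l) : ℝ) ^ 2 *
        (poch (α + β + 1) l.natAbs / poch (β + 1) l.natAbs)) * jacobiPoly α β l.natAbs =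
      ∑ p ∈ Finset.range m, Polynomial.monomial p (b p) := by
    refine Polynomial.funext fun z => ?_
    simpa [Polynomial.eval_finsetSum, eval_jacobiPoly] using hb z
  intro p hp
  obtain ⟨p, rfl⟩ := Nat.exists_eq_add_of_le' hp
  have hcoeff := congrArg (fun q => Polynomial.coeff q (p + 1)) hpoly
  simp only [Polynomial.finsetSum_coeff, Polynomial.coeff_C_mul, Polynomial.coeff_monomial,
    Finset.sum_ite_eq', Finset.mem_range, mul_assoc, poch_mul_coeff_jacobiPoly hβ] at hcoeff
  have hbp : (if p + 1 < m then b (p + 1) else 0) = b (p + 1) := by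
    split_ifs with hm
    · rfl
    · exact (hb0 _ (not_lt.1 hm)).symm
  rw [← hbp, ← hcoeff]
  simp only [mul_left_comm ((zchoose _ _ : ℝ) ^ 2), ← Finset.mul_sum]
  have := poch_pos (show 0 < β + 1 by linarith) (p + 1)
  exact mul_nonneg (by positivity) (sum_zchoose_sq_gegenbauerCoeff_nonneg hab hab' hk h p)
end

section
/- Let k be a positive integer and let M, N be nonnegative integers with |M − N| ≤ k. Then for every real number x, sin(x) · ∑_{l ∈ ℤ} C(M+N, M−kl)^2 · l · sin(l·x) ≥ 0. Equivalently, ∑_{l} C(M+N, M−kl)^2 · l·sin(lx)/sin(x) ≥ 0 wherever sin(x) ≠ 0. -/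
open Polynomial

lemma im_mul_im_sum_inv_neg (s : Multiset ℝ) (hs : s ≠ 0) (z : ℂ) (hz : z.im ≠ 0) :
    z.im * (s.map fun r : ℝ => 1 / (z - r)).sum.im < 0 := by
  have key (r : ℝ) : z.im * (1 / (z - r)).im < 0 := by
    have h : 0 < Complex.normSq (z - r) :=
      Complex.normSq_pos.2 fun h => hz (by simpa using congrArg Complex.im h)
    have : z.im * (1 / (z - r)).im = -(z.im ^ 2 / Complex.normSq (z - r)) := by
      simp [Complex.inv_im]; ring
    rw [this]
    have := sq_pos_of_ne_zero hz
    have := div_pos this h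
    linarith
  induction s using Multiset.induction with
  | empty => exact absurd rfl hs
  | cons a s ih =>
    rcases eq_or_ne s 0 with rfl | h
    · simpa using key a
    · have := ih h
      have := key a
      simp only [Multiset.map_cons, Multiset.sum_cons, Complex.add_im, mul_add]
      linarith

lemma splits_of_complex_roots_real {p : ℝ[X]} (h : ∀ z : ℂ, aeval z p = 0 → z.im = 0) :
    p.Splits := by
  refine Splits.of_splits_map (algebraMap ℝ ℂ) (IsAlgClosed.splits _) fun z hz => ?_
  have hz' : aeval z p = 0 := by
    have := (mem_roots'.1 hz).2
    rwa [IsRoot.def, eval_map_algebraMap] at this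
  exact ⟨z.re, Complex.ext (by simp) (by simp [h z hz'])⟩

lemma im_eq_zero_of_splits {p : ℝ[X]} (hp : p.Splits) (h0 : p ≠ 0) {z : ℂ}
    (hz : aeval z p = 0) : z.im = 0 := by
  obtain ⟨r, rfl⟩ := hp.mem_range_of_isRoot h0 (i := algebraMap ℝ ℂ) (x := z)
    (by rwa [IsRoot.def, eval_map_algebraMap])
  exact Complex.ofReal_im r

lemma splits_derivative_add_C_mul {p : ℝ[X]} (hp : p.Splits) (c : ℝ) :
    (derivative p + C c * p).Splits := by
  rcases eq_or_ne p.roots 0 with h | h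
  · have : p = C p.leadingCoeff := by simpa [h] using hp.eq_prod_roots
    rw [this, derivative_C, zero_add, ← C_mul]
    exact Splits.C _
  · have h0 : p ≠ 0 := by rintro rfl; simp at h
    refine splits_of_complex_roots_real fun z hz => ?_
    by_contra him
    have hpz : aeval z p ≠ 0 := fun h => him (im_eq_zero_of_splits hp h0 h)
    have := Splits.eval_derivative_div_eval_of_ne_zero (hp.map (algebraMap ℝ ℂ)) (x := z)
      (by rwa [eval_map_algebraMap])
    rw [hp.roots_map, derivative_map, eval_map_algebraMap, eval_map_algebraMap,
      Multiset.map_map] at this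
    have h1 : aeval z (derivative p) / aeval z p = ((-c : ℝ) : ℂ) := by
      rw [div_eq_iff hpz]
      simp at hz ⊢
      linear_combination hz
    have h2 := im_mul_im_sum_inv_neg p.roots h z him
    rw [h1] at this
    simp only [Function.comp_def, Complex.coe_algebraMap] at this
    rw [← this, Complex.ofReal_im] at h2
    simp at h2

lemma splits_aeval_derivative {p q : ℝ[X]} (hq : q.Splits) (hp : p.Splits) :
    (aeval (derivative : Module.End ℝ ℝ[X]) q p).Splits := by
  rw [splits_iff_exists_multiset'] at hq
  obtain ⟨m, hm⟩ := hq
  rw [hm]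
  clear hm
  generalize q.leadingCoeff = a
  induction m using Multiset.induction generalizing p with
  | empty =>
    simpa [Algebra.smul_def, smul_eq_C_mul] using hp.C_mul a
  | cons c m ih =>
    have : aeval (derivative : Module.End ℝ ℝ[X])
        (C a * ((c ::ₘ m).map fun x => X + C x).prod) p =
        aeval (derivative : Module.End ℝ ℝ[X])
        (C a * (m.map fun x => X + C x).prod) (derivative p + C c * p) := by
      rw [Multiset.map_cons, Multiset.prod_cons, mul_left_comm, mul_comm, map_mul]
      simp [Module.End.mul_apply, Algebra.smul_def]
    rw [this]
    exact ih (splits_derivative_add_C_mul hp c)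

lemma aeval_derivative_X_pow (n : ℕ) (c : ℕ → ℝ) :
    aeval (derivative : Module.End ℝ ℝ[X]) (∑ j ∈ Finset.range (n + 1), C (c j) * X ^ j) (X ^ n) =
      ∑ j ∈ Finset.range (n + 1), C (c j * n.descFactorial j) * X ^ (n - j) := by
  rw [map_sum, LinearMap.sum_apply]
  refine Finset.sum_congr rfl fun j _ => ?_
  rw [aeval_mul, aeval_X_pow, aeval_C, Module.End.mul_apply, Module.End.pow_apply,
    iterate_derivative_X_pow_eq_C_mul, Module.algebraMap_end_apply, smul_eq_C_mul, C_mul, mul_assoc]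

lemma splits_sum_choose_sq (n : ℕ) :
    (∑ j ∈ Finset.range (n + 1), C ((n.choose j : ℝ) ^ 2) * X ^ j).Splits := by
  have h1 : (∑ j ∈ Finset.range (n + 1), C (n.choose j : ℝ) * X ^ j).Splits := by
    have : (∑ j ∈ Finset.range (n + 1), C (n.choose j : ℝ) * X ^ j) = (X + C 1) ^ n := by
      rw [add_pow]
      refine Finset.sum_congr rfl fun j _ => ?_
      simp [mul_comm]
    rw [this]
    exact (Splits.X_add_C 1).pow n
  have h2 := splits_aeval_derivative h1 (Splits.X_pow n)
  rw [aeval_derivative_X_pow, ← Finset.sum_range_reflect] at h2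
  have h3 : (∑ j ∈ Finset.range (n + 1),
      C ((n.choose j : ℝ) * n.descFactorial (n - j)) * X ^ j).Splits := by
    convert h2 using 1
    refine Finset.sum_congr rfl fun j hj => ?_
    have hj : j ≤ n := by simpa [Nat.lt_succ_iff] using hj
    rw [show n + 1 - 1 - j = n - j by omega, Nat.sub_sub_self hj, Nat.choose_symm hj]
  have h4 := splits_aeval_derivative h3 (Splits.X_pow n)
  rw [aeval_derivative_X_pow, ← Finset.sum_range_reflect] at h4
  have h5 := h4.C_mul ((n.factorial : ℝ)⁻¹)
  rw [Finset.mul_sum] at h5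
  convert h5 using 1
  refine Finset.sum_congr rfl fun j hj => ?_
  have hj : j ≤ n := by simpa [Nat.lt_succ_iff] using hj
  rw [show n + 1 - 1 - j = n - j by omega, Nat.sub_sub_self hj, Nat.choose_symm hj,
    ← mul_assoc, ← C_mul]
  congr 2
  have e1 : (n.descFactorial j : ℝ) = n.choose j * j.factorial := by
    rw [Nat.descFactorial_eq_factorial_mul_choose]; push_cast; ring
  have e2 : (n.descFactorial (n - j) : ℝ) = n.choose j * (n - j).factorial := by
    rw [Nat.descFactorial_eq_factorial_mul_choose, Nat.choose_symm hj]; push_cast; ring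
  have e3 : (n.factorial : ℝ) = n.choose j * j.factorial * (n - j).factorial := by
    exact_mod_cast (Nat.choose_mul_factorial_mul_factorial hj).symm
  rw [e1, e2, eq_inv_mul_iff_mul_eq₀ (by positivity), e3]
  ring

/-- The cone of complex numbers whose argument lies in `[0, π)`, together with `0`. -/
def IsUpper (w : ℂ) : Prop := 0 < w.im ∨ (w.im = 0 ∧ 0 ≤ w.re)

lemma IsUpper.add {v w : ℂ} (hv : IsUpper v) (hw : IsUpper w) : IsUpper (v + w) := by
  unfold IsUpper at *
  simp only [Complex.add_im, Complex.add_re]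
  grind

lemma IsUpper.ofReal_mul {w : ℂ} (hw : IsUpper w) {a : ℝ} (ha : 0 ≤ a) : IsUpper (a * w) := by
  rcases ha.eq_or_lt with rfl | ha
  · simp [IsUpper]
  · rcases hw with h | ⟨h, h'⟩
    · left; simpa using mul_pos ha h
    · right; simpa [h] using mul_nonneg ha.le h'

lemma eq_zero_of_add_ofReal_mul_eq_zero {v w : ℂ} (h : IsUpper (v * star w)) {a : ℝ} (ha : 0 < a)
    (hs : v + a * w = 0) : w = 0 := by
  have hv : v = -(a * w) := eq_neg_of_add_eq_zero_left hs
  have e : v * star w = ((-(a * Complex.normSq w) : ℝ) : ℂ) := by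
    rw [hv, Complex.star_def, neg_mul, mul_assoc, Complex.mul_conj]; push_cast; ring
  rw [e] at h
  rcases h with h | ⟨-, h⟩
  · simp at h
  · rw [Complex.ofReal_re] at h
    have := Complex.normSq_nonneg w
    exact Complex.normSq_eq_zero.1 (by nlinarith)

/-- `z ^ (m / k)` if `k` divides `m`, and `0` otherwise. -/
noncomputable def dilate (z : ℂ) (k : ℕ) (m : ℤ) : ℂ := if (k : ℤ) ∣ m then z ^ (m / k) else 0

lemma dilate_add_self {z : ℂ} (hz : z ≠ 0) {k : ℕ} (hk : 0 < k) (m : ℤ) :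
    dilate z k (m + k) = z * dilate z k m := by
  have hk' : (k : ℤ) ≠ 0 := by exact_mod_cast hk.ne'
  unfold dilate
  by_cases h : (k : ℤ) ∣ m
  · rw [if_pos h, if_pos (by simpa using h), Int.add_ediv_of_dvd_left h, Int.ediv_self hk',
      zpow_add_one₀ hz, mul_comm]
  · rw [if_neg h, if_neg (by simpa using h), mul_zero]

/-- The section of `p` along the exponents congruent to `r` modulo `k`: the sum of
`p.coeff (r + k * l) * z ^ l` over all integers `l`. -/
noncomputable def sectionEval (z : ℂ) (k : ℕ) (r : ℤ) : ℝ[X] →ₗ[ℝ] ℂ :=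
  lsum fun j => LinearMap.toSpanSingleton ℝ ℂ (dilate z k (j - r))

lemma sectionEval_C_mul_X_pow (z : ℂ) (k : ℕ) (r : ℤ) (a : ℝ) (j : ℕ) :
    sectionEval z k r (C a * X ^ j) = a * dilate z k (j - r) := by
  rw [C_mul_X_pow_eq_monomial]
  simp [sectionEval, lsum_apply, sum_monomial_index]

lemma sectionEval_one (z : ℂ) (k : ℕ) (r : ℤ) : sectionEval z k r 1 = dilate z k (-r) := by
  simpa using sectionEval_C_mul_X_pow z k r 1 0

lemma sectionEval_X_mul (z : ℂ) (k : ℕ) (r : ℤ) (p : ℝ[X]) :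
    sectionEval z k r (X * p) = sectionEval z k (r - 1) p := by
  induction p using Polynomial.induction_on' with
  | add p q hp hq => rw [mul_add, map_add, map_add, hp, hq]
  | monomial j a =>
    rw [← C_mul_X_pow_eq_monomial, mul_left_comm, ← pow_succ', sectionEval_C_mul_X_pow,
      sectionEval_C_mul_X_pow]
    push_cast
    congr 2
    ring

lemma sectionEval_X_add_C_mul (z : ℂ) (k : ℕ) (r : ℤ) (a : ℝ) (p : ℝ[X]) :
    sectionEval z k r ((X + C a) * p) =
      sectionEval z k (r - 1) p + a * sectionEval z k r p := by
  rw [add_mul, map_add, sectionEval_X_mul, ← smul_eq_C_mul, map_smul, Complex.real_smul]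

lemma sectionEval_eq_mul_add {z : ℂ} (hz : z ≠ 0) {k : ℕ} (hk : 0 < k) (r : ℤ) (p : ℝ[X]) :
    sectionEval z k r p = z * sectionEval z k (r + k) p := by
  induction p using Polynomial.induction_on' with
  | add p q hp hq => rw [map_add, map_add, hp, hq, mul_add]
  | monomial j a =>
    rw [← C_mul_X_pow_eq_monomial, sectionEval_C_mul_X_pow, sectionEval_C_mul_X_pow,
      mul_left_comm, ← dilate_add_self hz hk]
    congr 2
    ring

lemma isUpper_sectionEval_of_lt {z : ℂ} (hz : z ≠ 0) (hu : IsUpper z) {k : ℕ} (hk : 0 < k)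
    {p : ℝ[X]} (h : ∀ s r : ℤ, s < r → r < s + k →
      IsUpper (sectionEval z k s p * star (sectionEval z k r p)))
    {s r : ℤ} (hsr : s ≤ r) (hrs : r ≤ s + k) :
    IsUpper (sectionEval z k s p * star (sectionEval z k r p)) := by
  rcases hsr.eq_or_lt with rfl | hsr
  · rw [Complex.star_def, Complex.mul_conj]
    exact Or.inr ⟨Complex.ofReal_im _, Complex.normSq_nonneg _⟩
  rcases hrs.eq_or_lt with rfl | hrs
  · rw [sectionEval_eq_mul_add hz hk, Complex.star_def, mul_assoc, Complex.mul_conj, mul_comm]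
    exact hu.ofReal_mul (Complex.normSq_nonneg _)
  · exact h s r hsr hrs

/-- Consecutive sections of a polynomial with negative roots have increasing arguments on the
upper half plane. -/
lemma isUpper_sectionEval {z : ℂ} (hz : z ≠ 0) (hu : IsUpper z) {k : ℕ} (hk : 0 < k)
    (m : Multiset ℝ) (hm : ∀ a ∈ m, 0 < a) {s r : ℤ} (hsr : s ≤ r) (hrs : r ≤ s + k) :
    IsUpper (sectionEval z k s (m.map fun a => X + C a).prod *
      star (sectionEval z k r (m.map fun a => X + C a).prod)) := by
  induction m using Multiset.induction generalizing s r with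
  | empty =>
    refine isUpper_sectionEval_of_lt hz hu hk (fun s r hsr hrs => ?_) hsr hrs
    simp only [Multiset.map_zero, Multiset.prod_zero, sectionEval_one, dilate, Int.dvd_neg]
    by_cases h1 : (k : ℤ) ∣ s
    · by_cases h2 : (k : ℤ) ∣ r
      · have := Int.le_of_dvd (by linarith) (dvd_sub h2 h1)
        linarith
      · simp [h2, IsUpper]
    · simp [h1, IsUpper]
  | cons a m ih =>
    have ha : 0 < a := hm a (Multiset.mem_cons_self a m)
    have ih {s r : ℤ} := @ih (fun b hb => hm b (Multiset.mem_cons_of_mem hb)) s r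
    refine isUpper_sectionEval_of_lt hz hu hk (fun s r hsr hrs => ?_) hsr hrs
    simp only [Multiset.map_cons, Multiset.prod_cons, sectionEval_X_add_C_mul]
    generalize (m.map fun a => X + C a).prod = p at ih
    have h1 := ih (s := s - 1) (r := r - 1) (by linarith) (by linarith)
    have h2 := (ih (s := s - 1) (r := r) (by linarith) (by linarith)).ofReal_mul ha.le
    have h3 := (ih (s := s) (r := r - 1) (by lia) (by linarith)).ofReal_mul ha.le
    have h4 := (ih (s := s) (r := r) (by linarith) (by linarith)).ofReal_mul
      (mul_nonneg ha.le ha.le)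
    convert ((h1.add h2).add h3).add h4 using 1
    simp
    ring

lemma sectionEval_ne_zero {z : ℂ} (hz : z ≠ 0) (hu : IsUpper z) {k : ℕ} (hk : 0 < k)
    (m : Multiset ℝ) (hm : ∀ a ∈ m, 0 < a) {r : ℤ} (h0 : 0 ≤ r) (hr : r ≤ m.card) :
    sectionEval z k r (m.map fun a => X + C a).prod ≠ 0 := by
  induction m using Multiset.induction generalizing r with
  | empty =>
    obtain rfl : r = 0 := by simp at hr; lia
    simp [sectionEval_one, dilate]
  | cons a m ih =>
    have ha : 0 < a := hm a (Multiset.mem_cons_self a m)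
    have hm' : ∀ b ∈ m, 0 < b := fun b hb => hm b (Multiset.mem_cons_of_mem hb)
    simp only [Multiset.map_cons, Multiset.prod_cons, sectionEval_X_add_C_mul]
    intro h
    have h1 := eq_zero_of_add_ofReal_mul_eq_zero
      (isUpper_sectionEval hz hu hk m hm' (by linarith) (by lia)) ha h
    rcases h0.eq_or_lt with rfl | h0
    · exact ih hm' le_rfl (by positivity) h1
    · rw [h1, mul_zero, add_zero] at h
      refine ih hm' (by lia) ?_ h
      rw [Multiset.card_cons] at hr
      push_cast at hr
      linarith

/-- The polynomial with coefficients the squares of the binomial coefficients. -/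
noncomputable def chooseSqPoly (n : ℕ) : ℝ[X] :=
  ∑ j ∈ Finset.range (n + 1), C ((n.choose j : ℝ) ^ 2) * X ^ j

lemma chooseSqPoly_eq_prod (n : ℕ) : ∃ m : Multiset ℝ, m.card = n ∧ (∀ a ∈ m, 0 < a) ∧
    chooseSqPoly n = (m.map fun a => X + C a).prod := by
  have hcoeff (i : ℕ) : (chooseSqPoly n).coeff i = (n.choose i : ℝ) ^ 2 := by
    simp only [chooseSqPoly, finsetSum_coeff, coeff_C_mul_X_pow]
    rw [Finset.sum_ite_eq]
    split_ifs with h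
    · rfl
    · rw [Nat.choose_eq_zero_of_lt (by simpa using h)]; simp
  have hdeg : (chooseSqPoly n).natDegree = n := by
    refine natDegree_eq_of_le_of_coeff_ne_zero ?_ (by simp [hcoeff])
    exact natDegree_le_iff_coeff_eq_zero.2 fun i hi => by
      rw [hcoeff, Nat.choose_eq_zero_of_lt hi]; simp
  have hmonic : (chooseSqPoly n).Monic := by
    rw [Monic, leadingCoeff, hdeg, hcoeff]; simp
  have hs : (chooseSqPoly n).Splits := splits_sum_choose_sq n
  refine ⟨(chooseSqPoly n).roots.map Neg.neg, ?_, ?_, ?_⟩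
  · rw [Multiset.card_map, ← hs.natDegree_eq_card_roots, hdeg]
  · intro a ha
    obtain ⟨r, hr, rfl⟩ := Multiset.mem_map.1 ha
    by_contra! h
    have h0 : 0 ≤ r := by linarith
    have hr : (chooseSqPoly n).eval r = 0 := (mem_roots'.1 hr).2
    have : 0 < (chooseSqPoly n).eval r := by
      simp only [chooseSqPoly, eval_finsetSum, eval_mul, eval_C, eval_pow, eval_X]
      exact Finset.sum_pos' (fun j _ => by positivity) ⟨0, by simp, by simp⟩
    linarith
  · conv_lhs => rw [hs.eq_prod_roots_of_monic hmonic]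
    simp [Multiset.map_map, sub_eq_add_neg]

lemma sectionEval_add_ne_zero {z : ℂ} (hz : z ≠ 0) (hu : IsUpper z) {k M N : ℕ} (hk : 0 < k)
    (h : |(M : ℤ) - N| ≤ k) :
    sectionEval z k M (chooseSqPoly (M + N)) + sectionEval z k N (chooseSqPoly (M + N)) ≠ 0 := by
  obtain ⟨m, hc, hm, hp⟩ := chooseSqPoly_eq_prod (M + N)
  rw [hp]
  have hM := sectionEval_ne_zero hz hu hk m hm (r := M) (by positivity) (by rw [hc]; simp)
  have hN := sectionEval_ne_zero hz hu hk m hm (r := N) (by positivity) (by rw [hc]; simp)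
  have key {s r : ℤ} (hsr : s ≤ r) (hrs : r ≤ s + k) (h0 : _ ≠ 0) :=
    mt (fun h => eq_zero_of_add_ofReal_mul_eq_zero (isUpper_sectionEval hz hu hk m hm hsr hrs) one_pos
      (by simpa using h)) h0
  rw [abs_le] at h
  rcases le_total (M : ℤ) N with hle | hle
  · exact key hle (by linarith) hN
  · rw [add_comm]
    exact key hle (by linarith) hM

lemma zchoose_natCast (n j : ℕ) : zchoose n j = n.choose j := by simp [zchoose]

lemma zchoose_symm (n : ℕ) (b : ℤ) : zchoose n (n - b) = zchoose n b := by
  unfold zchoose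
  split_ifs with h1 h2 h2
  · obtain ⟨c, rfl⟩ := Int.eq_ofNat_of_zero_le h2
    rw [Int.toNat_natCast, show ((n : ℤ) - c).toNat = n - c by lia, Nat.choose_symm (by lia)]
  · exact Nat.choose_eq_zero_of_lt (by lia)
  · exact (Nat.choose_eq_zero_of_lt (by lia)).symm
  · rfl

lemma sum_ite_zpow_neg (z : ℂ) {k : ℕ} (hk : 0 < k) {n : ℕ} {d : ℤ} (hd : |d| ≤ n) :
    ∑ l ∈ Finset.Icc (-(n : ℤ)) n, (if d = -(k * l) then z ^ (-l) else 0) = dilate z k d := by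
  have hk' : (k : ℤ) ≠ 0 := by exact_mod_cast hk.ne'
  unfold dilate
  split_ifs with h
  · obtain ⟨e, rfl⟩ := h
    have he : |e| ≤ n := by
      rw [abs_mul, Nat.abs_cast] at hd
      have : (1 : ℤ) ≤ k := by exact_mod_cast hk
      nlinarith [abs_nonneg e]
    rw [abs_le] at he
    rw [Int.mul_ediv_cancel_left _ hk', Finset.sum_eq_single (-e)]
    · simp
    · intro l _ hl
      rw [if_neg]
      intro h
      rw [← mul_neg, mul_right_inj' hk'] at h
      exact hl (by linarith)
    · intro h
      exact absurd (Finset.mem_Icc.2 ⟨by linarith, by linarith⟩) h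
  · refine Finset.sum_eq_zero fun l _ => if_neg ?_
    rintro rfl
    simp at h

lemma sum_zchoose_sq_zpow_neg (z : ℂ) {k : ℕ} (hk : 0 < k) {n M : ℕ} (hM : M ≤ n) :
    ∑ l ∈ Finset.Icc (-(n : ℤ)) n, (zchoose n (M - k * l) : ℂ) ^ 2 * z ^ (-l) =
      sectionEval z k M (chooseSqPoly n) := by
  have hinner (l : ℤ) : (zchoose n (M - k * l) : ℂ) ^ 2 * z ^ (-l) =
      ∑ j ∈ Finset.range (n + 1),
        (n.choose j : ℂ) ^ 2 * (if (j : ℤ) - M = -(k * l) then z ^ (-l) else 0) := by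
    have hiff (j : ℕ) : (j : ℤ) - M = -(k * l) ↔ (j : ℤ) = M - k * l := by
      constructor <;> intro h <;> linarith
    simp only [hiff]
    generalize (M : ℤ) - k * l = b
    by_cases hb : 0 ≤ b
    · obtain ⟨i, rfl⟩ := Int.eq_ofNat_of_zero_le hb
      simp only [Nat.cast_inj, mul_ite, mul_zero, Finset.sum_ite_eq', zchoose_natCast]
      split_ifs with h
      · rfl
      · rw [Nat.choose_eq_zero_of_lt (by simpa using h)]; simp
    · rw [Finset.sum_eq_zero]
      · simp [zchoose, hb]
      · intro j _
        rw [if_neg (by lia), mul_zero]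
  rw [chooseSqPoly, map_sum]
  simp only [hinner, sectionEval_C_mul_X_pow]
  rw [Finset.sum_comm]
  refine Finset.sum_congr rfl fun j hj => ?_
  rw [← Finset.mul_sum, sum_ite_zpow_neg z hk]
  · push_cast; rfl
  · have := Finset.mem_range.1 hj
    rw [abs_le]
    constructor <;> lia

lemma sum_zchoose_sq_zpow (z : ℂ) {k : ℕ} (hk : 0 < k) (M N : ℕ) :
    ∑ l ∈ Finset.Icc (-((M + N : ℕ) : ℤ)) (M + N : ℕ),
        (zchoose (M + N) (M - k * l) : ℂ) ^ 2 * z ^ l =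
      sectionEval z k N (chooseSqPoly (M + N)) := by
  rw [← sum_zchoose_sq_zpow_neg z hk (Nat.le_add_left N M)]
  refine Finset.sum_equiv (Equiv.neg ℤ) (fun l => ?_) fun l _ => ?_
  · simp only [Finset.mem_Icc, Equiv.neg_apply]
    constructor <;> rintro ⟨h1, h2⟩ <;> constructor <;> linarith
  · rw [← zchoose_symm, Equiv.neg_apply, neg_neg]
    congr 4
    push_cast
    ring

/-- The polynomial whose value at `cos x` is the sum of
`zchoose (M + N) (M - k * l) ^ 2 * cos (l * x)` over all integers `l`. -/
noncomputable def cosPoly (k M N : ℕ) : ℝ[X] :=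
  ∑ l ∈ Finset.Icc (-((M + N : ℕ) : ℤ)) (M + N : ℕ),
    C ((zchoose (M + N) (M - k * l) : ℝ) ^ 2) * Chebyshev.T ℝ l

lemma two_mul_aeval_cos_cosPoly {k : ℕ} (hk : 0 < k) (M N : ℕ) (θ : ℂ) :
    2 * aeval (Complex.cos θ) (cosPoly k M N) =
      sectionEval (Complex.exp (θ * Complex.I)) k M (chooseSqPoly (M + N)) +
        sectionEval (Complex.exp (θ * Complex.I)) k N (chooseSqPoly (M + N)) := by
  rw [← sum_zchoose_sq_zpow_neg _ hk (Nat.le_add_right M N), ← sum_zchoose_sq_zpow _ hk,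
    ← Finset.sum_add_distrib, cosPoly, map_sum, Finset.mul_sum]
  refine Finset.sum_congr rfl fun l _ => ?_
  have hT : 2 * Complex.cos (l * θ) =
      Complex.exp (θ * Complex.I) ^ (-l) + Complex.exp (θ * Complex.I) ^ l := by
    rw [Complex.two_cos, ← Complex.exp_int_mul, ← Complex.exp_int_mul, add_comm]
    congr 2 <;> push_cast <;> ring
  rw [_root_.map_mul, aeval_C, Chebyshev.aeval_T, Chebyshev.T_complex_cos, ← mul_add, ← hT]
  simp
  ring

lemma aeval_cosPoly_root {k M N : ℕ} (hk : 0 < k) (h : |(M : ℤ) - N| ≤ k) {u : ℂ}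
    (hu : aeval u (cosPoly k M N) = 0) : u.im = 0 ∧ u.re ≤ -1 := by
  obtain ⟨θ, rfl⟩ := Complex.cos_surjective u
  have hnot (φ : ℂ) (hφ : aeval (Complex.cos φ) (cosPoly k M N) = 0) :
      ¬ IsUpper (Complex.exp (φ * Complex.I)) := fun hup =>
    sectionEval_add_ne_zero (Complex.exp_ne_zero _) hup hk h
      (by rw [← two_mul_aeval_cos_cosPoly hk, hφ, mul_zero])
  have h1 := hnot θ hu
  have h2 := hnot (-θ) (by rwa [Complex.cos_neg])
  have hcos := Complex.two_cos θ
  rw [neg_mul, Complex.exp_neg] at h2 hcos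
  have hz := Complex.exp_ne_zero (θ * Complex.I)
  generalize Complex.exp (θ * Complex.I) = z at *
  have hpos := Complex.normSq_pos.2 hz
  simp only [IsUpper, not_or, not_and, not_lt, not_le, Complex.inv_im] at h1 h2
  have him : z.im = 0 := by
    refine le_antisymm h1.1 ?_
    have := h2.1
    rw [div_le_iff₀ hpos] at this
    linarith
  have hre := h1.2 him
  obtain ⟨x, rfl⟩ : ∃ x : ℝ, z = x := ⟨z.re, Complex.ext rfl (by simp [him])⟩
  have hc : Complex.cos θ = (((x + x⁻¹) / 2 : ℝ) : ℂ) := by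
    push_cast; linear_combination hcos / 2
  rw [hc]
  refine ⟨Complex.ofReal_im _, ?_⟩
  rw [Complex.ofReal_re]
  rw [Complex.ofReal_re] at hre
  have : x * x⁻¹ = 1 := mul_inv_cancel₀ hre.ne
  have : x⁻¹ < 0 := inv_lt_zero.2 hre
  nlinarith [sq_nonneg (x - x⁻¹)]

lemma eval_derivative_nonneg_of_splits {p : ℝ[X]} (hp : p.Splits) {a x y : ℝ}
    (hroots : ∀ r ∈ p.roots, r ≤ a) (hx : a < x) (hy : a < y) (hpy : 0 < p.eval y) :
    0 ≤ (derivative p).eval x := by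
  have hprod {t : ℝ} (ht : a < t) : 0 < (p.roots.map (t - ·)).prod :=
    Multiset.prod_pos fun b hb => by
      obtain ⟨r, hr, rfl⟩ := Multiset.mem_map.1 hb
      linarith [hroots r hr]
  rw [hp.eval_eq_prod_roots] at hpy
  have hpx : 0 < p.eval x := by
    rw [hp.eval_eq_prod_roots]
    exact mul_pos (pos_of_mul_pos_left hpy (hprod hy).le) (hprod hx)
  rw [hp.eval_derivative_eq_eval_mul_sum hpx.ne']
  refine mul_nonneg hpx.le (Multiset.sum_nonneg fun b hb => ?_)
  obtain ⟨r, hr, rfl⟩ := Multiset.mem_map.1 hb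
  have := hroots r hr
  exact one_div_nonneg.2 (by linarith)

lemma eval_one_cosPoly_pos (k M N : ℕ) : 0 < (cosPoly k M N).eval 1 := by
  simp only [cosPoly, eval_finsetSum, eval_mul, eval_C, Chebyshev.T_eval_one, mul_one]
  refine Finset.sum_pos' (fun l _ => by positivity) ⟨0, by simp; positivity, ?_⟩
  rw [mul_zero, sub_zero, zchoose_natCast]
  have := Nat.choose_pos (Nat.le_add_right M N)
  positivity

theorem stmt15 (k M N : ℕ) (hk : 0 < k) (h : |(M : ℤ) - N| ≤ k) (x : ℝ) :
    0 ≤ Real.sin x *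
      ∑ l ∈ Finset.Icc (-((M : ℤ) + N)) ((M : ℤ) + N),
        (zchoose (M + N) ((M : ℤ) - k * l) : ℝ) ^ 2 * ((l : ℝ) * Real.sin (l * x)) := by
  have hsum : ∑ l ∈ Finset.Icc (-((M : ℤ) + N)) ((M : ℤ) + N),
      (zchoose (M + N) ((M : ℤ) - k * l) : ℝ) ^ 2 * ((l : ℝ) * Real.sin (l * x)) =
      (derivative (cosPoly k M N)).eval (Real.cos x) * Real.sin x := by
    rw [cosPoly, derivative_sum, eval_finsetSum, Finset.sum_mul]
    push_cast
    refine Finset.sum_congr rfl fun l _ => ?_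
    have hU := Chebyshev.U_real_cos x (l - 1)
    rw [derivative_C_mul, Chebyshev.T_derivative_eq_U]
    simp only [eval_mul, eval_C, eval_intCast]
    rw [mul_assoc, mul_assoc, hU]
    simp
  rw [hsum, mul_left_comm, ← sq]
  rcases eq_or_ne (Real.sin x) 0 with hs | hs
  · simp [hs]
  have hcos : -1 < Real.cos x := by
    nlinarith [Real.sin_sq_add_cos_sq x, sq_pos_of_ne_zero hs, Real.neg_one_le_cos x]
  refine mul_nonneg (eval_derivative_nonneg_of_splits (a := -1) (y := 1) ?_ ?_ hcos (by norm_num)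
    (eval_one_cosPoly_pos k M N)) (sq_nonneg _)
  · exact splits_of_complex_roots_real fun z hz => (aeval_cosPoly_root hk h hz).1
  · intro r hr
    have hr : (cosPoly k M N).eval r = 0 := (mem_roots'.1 hr).2
    have : aeval (r : ℂ) (cosPoly k M N) = 0 := by
      rw [← Complex.coe_algebraMap, aeval_algebraMap_apply_eq_algebraMap_eval, hr, map_zero]
    exact (aeval_cosPoly_root hk h this).2
end
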